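/- arXiv:2006.15306 — 7 statements merged into one kernel-verified Lean document; each statement's English description precedes it below -/
import Mathlib

section
/- Let G be a two-player game and let (s_1*, s_2*) be a Nash equilibrium of G. Define the constant (blind) biased beliefs ψ_1* ≡ s_2* and ψ_2* ≡ s_1* (i.e., ψ_1*(t) = s_2* for all t ∈ S_2 and ψ_2*(t) = s_1* for all t ∈ S_1). Then: (a) ((ψ_1*, ψ_2*), (s_1*, s_2*)) is a weak BBE, and moreover for each player i and each biased belief ψ'_i there exists a plausible Nash equilibrium (s'_i, s'_j) of G_{(ψ'_i, ψ_j*)} with π_i(s'_i, s'_j) ≤ π_i(s_1*, s_2*); (b) if in addition (s_1*, s_2*) is a strict Nash equilibrium, i.e., for each player i the strategy s_i* is the unique maximizer of t ↦ π_i(t, s_j*) over S_i, then π_i(s'_i, s'_j) ≤ π_i(s_1*, s_2*) holds for every player i, every biased belief ψ'_i, and every (s'_i, s'_j) ∈ NE(G_{(ψ'_i, ψ_j*)}). -/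
open Set

namespace BBEPaper

section Defs

variable {E F : Type*} [TopologicalSpace E] [TopologicalSpace F]

/-- Best replies of player 1 against player 2's strategy `s2`. -/
def BR1 (S1 : Set E) (π1 : E → F → ℝ) (s2 : F) : Set E :=
  {t | t ∈ S1 ∧ ∀ t' ∈ S1, π1 t' s2 ≤ π1 t s2}

/-- Best replies of player 2 against player 1's strategy `s1`. -/
def BR2 (S2 : Set F) (π2 : E → F → ℝ) (s1 : E) : Set F :=
  {t | t ∈ S2 ∧ ∀ t' ∈ S2, π2 s1 t' ≤ π2 s1 t}

/-- A biased belief on the opponent's strategy set `S`: a continuous self-map of `S`. -/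
def IsBelief {G : Type*} [TopologicalSpace G] (S : Set G) (ψ : G → G) : Prop :=
  Set.MapsTo ψ S S ∧ ContinuousOn ψ S

/-- Nash equilibrium of the biased game `G_(ψ1, ψ2)`. -/
def BiasedNE (S1 : Set E) (S2 : Set F) (π1 π2 : E → F → ℝ)
    (ψ1 : F → F) (ψ2 : E → E) (s1 : E) (s2 : F) : Prop :=
  s1 ∈ S1 ∧ s2 ∈ S2 ∧
  (∀ t ∈ S1, π1 t (ψ1 s2) ≤ π1 s1 (ψ1 s2)) ∧
  (∀ t ∈ S2, π2 (ψ2 s1) t ≤ π2 (ψ2 s1) s2)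

/-- Weak biased-belief equilibrium. -/
def WeakBBE (S1 : Set E) (S2 : Set F) (π1 π2 : E → F → ℝ)
    (ψ1 : F → F) (ψ2 : E → E) (s1 : E) (s2 : F) : Prop :=
  IsBelief S2 ψ1 ∧ IsBelief S1 ψ2 ∧
  BiasedNE S1 S2 π1 π2 ψ1 ψ2 s1 s2 ∧
  (∀ ψ1' : F → F, IsBelief S2 ψ1' → ∃ s1' s2',
     BiasedNE S1 S2 π1 π2 ψ1' ψ2 s1' s2' ∧ π1 s1' s2' ≤ π1 s1 s2) ∧
  (∀ ψ2' : E → E, IsBelief S1 ψ2' → ∃ s1' s2',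
     BiasedNE S1 S2 π1 π2 ψ1 ψ2' s1' s2' ∧ π2 s1' s2' ≤ π2 s1 s2)

/-- Implausible equilibrium after a deviation of player 1 to `ψ1'`. -/
def Implausible1 (S1 : Set E) (S2 : Set F) (π1 π2 : E → F → ℝ)
    (ψ1' : F → F) (ψ2 : E → E) (s1 : E) (s2 : F) (s1' : E) (s2' : F) : Prop :=
  ψ2 s1' = ψ2 s1 ∧ s2' ≠ s2 ∧ BiasedNE S1 S2 π1 π2 ψ1' ψ2 s1' s2

/-- Implausible equilibrium after a deviation of player 2 to `ψ2'`. -/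
def Implausible2 (S1 : Set E) (S2 : Set F) (π1 π2 : E → F → ℝ)
    (ψ1 : F → F) (ψ2' : E → E) (s1 : E) (s2 : F) (s1' : E) (s2' : F) : Prop :=
  ψ1 s2' = ψ1 s2 ∧ s1' ≠ s1 ∧ BiasedNE S1 S2 π1 π2 ψ1 ψ2' s1 s2'

/-- For each deviation of either player there is a plausible equilibrium of the new biased
game in which the deviator is weakly outperformed. -/
def PlausiblyResists (S1 : Set E) (S2 : Set F) (π1 π2 : E → F → ℝ)
    (ψ1 : F → F) (ψ2 : E → E) (s1 : E) (s2 : F) : Prop :=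
  (∀ ψ1' : F → F, IsBelief S2 ψ1' → ∃ s1' s2',
     BiasedNE S1 S2 π1 π2 ψ1' ψ2 s1' s2' ∧
     ¬ Implausible1 S1 S2 π1 π2 ψ1' ψ2 s1 s2 s1' s2' ∧
     π1 s1' s2' ≤ π1 s1 s2) ∧
  (∀ ψ2' : E → E, IsBelief S1 ψ2' → ∃ s1' s2',
     BiasedNE S1 S2 π1 π2 ψ1 ψ2' s1' s2' ∧
     ¬ Implausible2 S1 S2 π1 π2 ψ1 ψ2' s1 s2 s1' s2' ∧
     π2 s1' s2' ≤ π2 s1 s2)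

/-- For each deviation of either player, the deviator is weakly outperformed in every
equilibrium of the new biased game. -/
def StrongResists (S1 : Set E) (S2 : Set F) (π1 π2 : E → F → ℝ)
    (ψ1 : F → F) (ψ2 : E → E) (s1 : E) (s2 : F) : Prop :=
  (∀ ψ1' : F → F, IsBelief S2 ψ1' → ∀ s1' s2',
     BiasedNE S1 S2 π1 π2 ψ1' ψ2 s1' s2' → π1 s1' s2' ≤ π1 s1 s2) ∧
  (∀ ψ2' : E → E, IsBelief S1 ψ2' → ∀ s1' s2',
     BiasedNE S1 S2 π1 π2 ψ1 ψ2' s1' s2' → π2 s1' s2' ≤ π2 s1 s2)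

/-- A strategy of player 1 is undominated if it is a best reply to some strategy in `S2`. -/
def Undominated1 (S1 : Set E) (S2 : Set F) (π1 : E → F → ℝ) (s1 : E) : Prop :=
  ∃ s2 ∈ S2, s1 ∈ BR1 S1 π1 s2

/-- A strategy of player 2 is undominated if it is a best reply to some strategy in `S1`. -/
def Undominated2 (S1 : Set E) (S2 : Set F) (π2 : E → F → ℝ) (s2 : F) : Prop :=
  ∃ s1 ∈ S1, s2 ∈ BR2 S2 π2 s1

/-- Undominated minmax payoff of player 1. -/
noncomputable def M1U (S1 : Set E) (S2 : Set F) (π1 π2 : E → F → ℝ) : ℝ :=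
  sInf ((fun s2 => sSup ((fun s1 => π1 s1 s2) '' S1)) '' {s2 | Undominated2 S1 S2 π2 s2})

/-- Undominated minmax payoff of player 2. -/
noncomputable def M2U (S1 : Set E) (S2 : Set F) (π1 π2 : E → F → ℝ) : ℝ :=
  sInf ((fun s1 => sSup ((fun s2 => π2 s1 s2) '' S2)) '' {s1 | Undominated1 S1 S2 π1 s1})

/-- Biased-belief minmax payoff of player 1. -/
noncomputable def Mtilde1U (S1 : Set E) (S2 : Set F) (π1 π2 : E → F → ℝ) : ℝ :=
  sInf ((fun s1' => sSup {y | ∃ s1 ∈ S1, ∃ s2 ∈ BR2 S2 π2 s1', y = π1 s1 s2}) ''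
    {s1 | Undominated1 S1 S2 π1 s1})

/-- Biased-belief minmax payoff of player 2. -/
noncomputable def Mtilde2U (S1 : Set E) (S2 : Set F) (π1 π2 : E → F → ℝ) : ℝ :=
  sInf ((fun s2' => sSup {y | ∃ s2 ∈ S2, ∃ s1 ∈ BR1 S1 π1 s2', y = π2 s1 s2}) ''
    {s2 | Undominated2 S1 S2 π2 s2})

end Defs

end BBEPaper

open BBEPaper

/-- Any Nash equilibrium is supported as a weak BBE by the blind beliefs
ψ1* ≡ s2*, ψ2* ≡ s1*; moreover each deviation is outperformed in some plausible equilibrium,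
and if the Nash equilibrium is strict, in every equilibrium of the new biased game. -/
theorem nash_is_BBE_with_blind_beliefs
    {E F : Type*} [NormedAddCommGroup E] [NormedSpace ℝ E] [FiniteDimensional ℝ E]
    [NormedAddCommGroup F] [NormedSpace ℝ F] [FiniteDimensional ℝ F]
    (S1 : Set E) (S2 : Set F)
    (hne1 : S1.Nonempty) (hcp1 : IsCompact S1) (hcv1 : Convex ℝ S1)
    (hne2 : S2.Nonempty) (hcp2 : IsCompact S2) (hcv2 : Convex ℝ S2)
    (π1 π2 : E → F → ℝ)
    (hct1 : ContinuousOn (Function.uncurry π1) (S1 ×ˢ S2))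
    (hct2 : ContinuousOn (Function.uncurry π2) (S1 ×ˢ S2))
    (hcc1 : ∀ s2 ∈ S2, ConcaveOn ℝ S1 (fun t => π1 t s2))
    (hcc2 : ∀ s1 ∈ S1, ConcaveOn ℝ S2 (fun t => π2 s1 t))
    (s1 : E) (s2 : F)
    (hNE1 : s1 ∈ BR1 S1 π1 s2) (hNE2 : s2 ∈ BR2 S2 π2 s1) :
    (WeakBBE S1 S2 π1 π2 (fun _ => s2) (fun _ => s1) s1 s2 ∧
      PlausiblyResists S1 S2 π1 π2 (fun _ => s2) (fun _ => s1) s1 s2) ∧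
    (((∀ t ∈ S1, t ≠ s1 → π1 t s2 < π1 s1 s2) ∧
      (∀ t ∈ S2, t ≠ s2 → π2 s1 t < π2 s1 s2)) →
      StrongResists S1 S2 π1 π2 (fun _ => s2) (fun _ => s1) s1 s2) := by
  obtain ⟨h1, hb1⟩ := hNE1
  obtain ⟨h2, hb2⟩ := hNE2
  have key : PlausiblyResists S1 S2 π1 π2 (fun _ => s2) (fun _ => s1) s1 s2 := by
    constructor
    · intro ψ hψ
      have hc : ContinuousOn (fun t => π1 t (ψ s2)) S1 :=
        hct1.comp (f := fun t => (t, ψ s2)) (by fun_prop) (fun t ht => ⟨ht, hψ.1 h2⟩)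
      obtain ⟨t, ht, hm⟩ := hcp1.exists_isMaxOn hne1 hc
      exact ⟨t, s2, ⟨ht, h2, fun u hu => hm hu, hb2⟩, fun h => h.2.1 rfl, hb1 t ht⟩
    · intro ψ hψ
      have hc : ContinuousOn (fun t => π2 (ψ s1) t) S2 :=
        hct2.comp (f := fun t => (ψ s1, t)) (by fun_prop) (fun t ht => ⟨hψ.1 h1, ht⟩)
      obtain ⟨t, ht, hm⟩ := hcp2.exists_isMaxOn hne2 hc
      exact ⟨s1, t, ⟨h1, ht, hb1, fun u hu => hm hu⟩, fun h => h.2.1 rfl, hb2 t ht⟩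
  refine ⟨⟨⟨⟨fun _ _ => h2, continuousOn_const⟩, ⟨fun _ _ => h1, continuousOn_const⟩,
    ⟨h1, h2, hb1, hb2⟩, ?_, ?_⟩, key⟩, ?_⟩
  · intro ψ hψ
    obtain ⟨a, b, h, -, h'⟩ := key.1 ψ hψ
    exact ⟨a, b, h, h'⟩
  · intro ψ hψ
    obtain ⟨a, b, h, -, h'⟩ := key.2 ψ hψ
    exact ⟨a, b, h, h'⟩
  · rintro ⟨hs1, hs2⟩
    constructor
    · rintro ψ - a b ⟨ha, hb, -, hB⟩
      have hbe : b = s2 := by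
        by_contra hne
        exact absurd (hB s2 h2) (not_le.mpr (hs2 b hb hne))
      rw [hbe]
      exact hb1 a ha
    · rintro ψ - a b ⟨ha, hb, hA, -⟩
      have hae : a = s1 := by
        by_contra hne
        exact absurd (hA s1 h1) (not_le.mpr (hs1 a ha hne))
      rw [hae]
      exact hb2 b hb
end

section
/- Let G be a two-player zero-sum game: there is a constant c ∈ ℝ with π_1(s_1, s_2) + π_2(s_1, s_2) = c for all (s_1, s_2) ∈ S_1 × S_2. Suppose v_1, v_2 ∈ ℝ satisfy v_i = inf_{s_j ∈ S_j} sup_{s_i ∈ S_i} π_i(s_i, s_j) for each player i, and v_1 + v_2 = c (i.e., v_i is the value of the game for player i). Then every weak BBE ((ψ_1*, ψ_2*), (s_1*, s_2*)) satisfies π_i(s_1*, s_2*) = v_i for each player i. -/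
open Set

open BBEPaper

theorem BBE_aux {E F : Type*} [TopologicalSpace E] [TopologicalSpace F]
    (S1 : Set E) (S2 : Set F) (hne1 : S1.Nonempty) (hcp1 : IsCompact S1) (hcp2 : IsCompact S2)
    (f : E → F → ℝ) (hct : ContinuousOn (Function.uncurry f) (S1 ×ˢ S2))
    (a : E) (b : F) (hb : b ∈ S2) (hbest : ∀ t ∈ S1, f t b ≤ f a b) :
    sInf ((fun s2 => sSup ((fun s1 => f s1 s2) '' S1)) '' S2) ≤ f a b := by
  have hK := (hcp1.prod hcp2)
  obtain ⟨M, hM⟩ := hK.bddAbove_image hct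
  obtain ⟨m, hm⟩ := hK.bddBelow_image hct
  have hM' : ∀ x ∈ S1, ∀ y ∈ S2, f x y ≤ M := fun x hx y hy =>
    hM (Set.mem_image_of_mem (Function.uncurry f) (Set.mk_mem_prod hx hy))
  have hm' : ∀ x ∈ S1, ∀ y ∈ S2, m ≤ f x y := fun x hx y hy =>
    hm (Set.mem_image_of_mem (Function.uncurry f) (Set.mk_mem_prod hx hy))
  have h1 : sSup ((fun s1 => f s1 b) '' S1) ≤ f a b := by
    apply csSup_le (hne1.image _)
    rintro _ ⟨t, ht, rfl⟩
    exact hbest t ht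
  refine le_trans (csInf_le ⟨m, ?_⟩ ⟨b, hb, rfl⟩) h1
  rintro _ ⟨y, hy, rfl⟩
  obtain ⟨x, hx⟩ := hne1
  refine le_trans (hm' x hx y hy) (le_csSup ⟨M, ?_⟩ ⟨x, hx, rfl⟩)
  rintro _ ⟨t, ht, rfl⟩
  exact hM' t ht y hy

/-- In a zero-sum game, the payoff of every weak BBE is the value of
the game. -/
theorem weakBBE_payoff_eq_value_of_zero_sum
    {E F : Type*} [NormedAddCommGroup E] [NormedSpace ℝ E] [FiniteDimensional ℝ E]
    [NormedAddCommGroup F] [NormedSpace ℝ F] [FiniteDimensional ℝ F]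
    (S1 : Set E) (S2 : Set F)
    (hne1 : S1.Nonempty) (hcp1 : IsCompact S1) (hcv1 : Convex ℝ S1)
    (hne2 : S2.Nonempty) (hcp2 : IsCompact S2) (hcv2 : Convex ℝ S2)
    (π1 π2 : E → F → ℝ)
    (hct1 : ContinuousOn (Function.uncurry π1) (S1 ×ˢ S2))
    (hct2 : ContinuousOn (Function.uncurry π2) (S1 ×ˢ S2))
    (hcc1 : ∀ s2 ∈ S2, ConcaveOn ℝ S1 (fun t => π1 t s2))
    (hcc2 : ∀ s1 ∈ S1, ConcaveOn ℝ S2 (fun t => π2 s1 t))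
    (c : ℝ) (hzs : ∀ s1 ∈ S1, ∀ s2 ∈ S2, π1 s1 s2 + π2 s1 s2 = c)
    (v1 v2 : ℝ)
    (hv1 : v1 = sInf ((fun s2 => sSup ((fun s1 => π1 s1 s2) '' S1)) '' S2))
    (hv2 : v2 = sInf ((fun s1 => sSup ((fun s2 => π2 s1 s2) '' S2)) '' S1))
    (hvc : v1 + v2 = c)
    (ψ1 : F → F) (ψ2 : E → E) (s1 : E) (s2 : F)
    (h : WeakBBE S1 S2 π1 π2 ψ1 ψ2 s1 s2) :
    π1 s1 s2 = v1 ∧ π2 s1 s2 = v2 := by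
  obtain ⟨_, _, ⟨hs1, hs2, _, _⟩, hd1, hd2⟩ := h
  obtain ⟨a, b, ⟨ha, hb, hab, _⟩, hle⟩ := hd1 id ⟨fun x hx => hx, continuousOn_id⟩
  obtain ⟨a', b', ⟨ha', hb', _, hab'⟩, hle'⟩ := hd2 id ⟨fun x hx => hx, continuousOn_id⟩
  have k1 := BBE_aux S1 S2 hne1 hcp1 hcp2 π1 hct1 a b hb hab
  have hsw : ContinuousOn (Function.uncurry (fun y x => π2 x y)) (S2 ×ˢ S1) :=
    hct2.comp (f := Prod.swap) continuous_swap.continuousOn (fun p hp => ⟨hp.2, hp.1⟩)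
  have k2 := BBE_aux S2 S1 hne2 hcp2 hcp1 (fun y x => π2 x y) hsw b' a' ha' hab'
  have hz := hzs s1 hs1 s2 hs2
  rw [← hv1] at k1
  rw [← hv2] at k2
  constructor <;> linarith
end

section
/- Let G be a two-player game that admits a strictly dominant strategy s_i* for some player i: for every s_j ∈ S_j and every s_i ∈ S_i with s_i ≠ s_i*, π_i(s_i*, s_j) > π_i(s_i, s_j). Then the outcome (s_1*, s_2*) of any weak BBE ((ψ_1*, ψ_2*), (s_1*, s_2*)) is a Nash equilibrium of the underlying game G. -/
open Set

open BBEPaper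

/-- If some player has a strictly dominant strategy, then any weak BBE
outcome is a Nash equilibrium of the underlying game. -/
theorem weakBBE_outcome_is_nash_of_dominant_strategy
    {E F : Type*} [NormedAddCommGroup E] [NormedSpace ℝ E] [FiniteDimensional ℝ E]
    [NormedAddCommGroup F] [NormedSpace ℝ F] [FiniteDimensional ℝ F]
    (S1 : Set E) (S2 : Set F)
    (hne1 : S1.Nonempty) (hcp1 : IsCompact S1) (hcv1 : Convex ℝ S1)
    (hne2 : S2.Nonempty) (hcp2 : IsCompact S2) (hcv2 : Convex ℝ S2)
    (π1 π2 : E → F → ℝ)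
    (hct1 : ContinuousOn (Function.uncurry π1) (S1 ×ˢ S2))
    (hct2 : ContinuousOn (Function.uncurry π2) (S1 ×ˢ S2))
    (hcc1 : ∀ s2 ∈ S2, ConcaveOn ℝ S1 (fun t => π1 t s2))
    (hcc2 : ∀ s1 ∈ S1, ConcaveOn ℝ S2 (fun t => π2 s1 t))
    (hdom : (∃ d ∈ S1, ∀ s2 ∈ S2, ∀ t ∈ S1, t ≠ d → π1 t s2 < π1 d s2) ∨
            (∃ d ∈ S2, ∀ s1 ∈ S1, ∀ t ∈ S2, t ≠ d → π2 s1 t < π2 s1 d))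
    (ψ1 : F → F) (ψ2 : E → E) (s1 : E) (s2 : F)
    (h : WeakBBE S1 S2 π1 π2 ψ1 ψ2 s1 s2) :
    s1 ∈ BR1 S1 π1 s2 ∧ s2 ∈ BR2 S2 π2 s1 := by
  obtain ⟨⟨hm1, -⟩, ⟨hm2, -⟩, ⟨h1, h2, hb1, hb2⟩, hd1, hd2⟩ := h
  rcases hdom with ⟨d, hd, hdd⟩ | ⟨d, hd, hdd⟩
  · have key : ∀ a ∈ S1, ∀ y ∈ S2, (∀ t ∈ S1, π1 t y ≤ π1 a y) → a = d := by
      intro a ha y hy hmax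
      by_contra hne
      exact absurd (hmax d hd) (not_le.mpr (hdd y hy a ha hne))
    have e1 : s1 = d := key s1 h1 _ (hm1 h2) hb1
    obtain ⟨a, b, ⟨ha, hb, hab1, hab2⟩, hle⟩ := hd2 id ⟨fun x hx => hx, continuousOn_id⟩
    have e2 : a = d := key a ha _ (hm1 hb) hab1
    subst e1
    subst e2
    refine ⟨⟨h1, fun t ht => ?_⟩, h2, fun t ht => (hab2 t ht).trans hle⟩
    by_cases hta : t = a
    · rw [hta]
    · exact (hdd s2 h2 t ht hta).le
  · have key : ∀ a ∈ S2, ∀ y ∈ S1, (∀ t ∈ S2, π2 y t ≤ π2 y a) → a = d := by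
      intro a ha y hy hmax
      by_contra hne
      exact absurd (hmax d hd) (not_le.mpr (hdd y hy a ha hne))
    have e1 : s2 = d := key s2 h2 _ (hm2 h1) hb2
    obtain ⟨a, b, ⟨ha, hb, hab1, hab2⟩, hle⟩ := hd1 id ⟨fun x hx => hx, continuousOn_id⟩
    have e2 : b = d := key b hb _ (hm2 ha) hab2
    subst e1
    subst e2
    refine ⟨⟨h1, fun t ht => (hab1 t ht).trans hle⟩, h2, fun t ht => ?_⟩
    by_cases hta : t = b
    · rw [hta]
    · exact (hdd s1 h1 t ht hta).le
end

section
/- Let G be a two-player game and suppose the strategy profile s* = (s_1*, s_2*) is a weak BBE outcome, i.e., there exist biased beliefs ψ* = (ψ_1*, ψ_2*) such that (ψ*, s*) is a weak BBE. Then: (1) the profile s* is undominated, and (2) π_i(s_1*, s_2*) ≥ M_i^U for each player i. -/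
open Set

open BBEPaper

theorem minmax_aux {A B : Type*} [TopologicalSpace A] [TopologicalSpace B]
    (S : Set A) (T U : Set B) (hS : IsCompact S) (hT : IsCompact T) (hne : S.Nonempty)
    (hU : U ⊆ T) (f : A → B → ℝ)
    (hf : ContinuousOn (Function.uncurry f) (S ×ˢ T)) (a : A) (b : B) (hb : b ∈ U)
    (hmax : ∀ t ∈ S, f t b ≤ f a b) :
    sInf ((fun y => sSup ((fun x => f x y) '' S)) '' U) ≤ f a b := by
  obtain ⟨m, hm⟩ := (hS.prod hT).bddBelow_image hf
  obtain ⟨M, hM⟩ := (hS.prod hT).bddAbove_image hf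
  have hlow : ∀ x ∈ S, ∀ y ∈ T, m ≤ f x y := fun x hx y hy =>
    hm ⟨(x, y), ⟨hx, hy⟩, rfl⟩
  have hup : ∀ x ∈ S, ∀ y ∈ T, f x y ≤ M := fun x hx y hy =>
    hM ⟨(x, y), ⟨hx, hy⟩, rfl⟩
  have hbdd : BddBelow ((fun y => sSup ((fun x => f x y) '' S)) '' U) := by
    refine ⟨m, ?_⟩
    rintro _ ⟨y, hy, rfl⟩
    obtain ⟨x, hx⟩ := hne
    refine (hlow x hx y (hU hy)).trans (le_csSup ⟨M, ?_⟩ ⟨x, hx, rfl⟩)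
    rintro _ ⟨z, hz, rfl⟩
    exact hup z hz y (hU hy)
  refine (csInf_le hbdd ⟨b, hb, rfl⟩).trans (csSup_le (hne.image _) ?_)
  rintro _ ⟨z, hz, rfl⟩
  exact hmax z hz

/-- Any weak BBE outcome is undominated and gives each player a payoff
at least his undominated minmax payoff. -/
theorem weakBBE_outcome_undominated_and_above_minmax
    {E F : Type*} [NormedAddCommGroup E] [NormedSpace ℝ E] [FiniteDimensional ℝ E]
    [NormedAddCommGroup F] [NormedSpace ℝ F] [FiniteDimensional ℝ F]
    (S1 : Set E) (S2 : Set F)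
    (hne1 : S1.Nonempty) (hcp1 : IsCompact S1) (hcv1 : Convex ℝ S1)
    (hne2 : S2.Nonempty) (hcp2 : IsCompact S2) (hcv2 : Convex ℝ S2)
    (π1 π2 : E → F → ℝ)
    (hct1 : ContinuousOn (Function.uncurry π1) (S1 ×ˢ S2))
    (hct2 : ContinuousOn (Function.uncurry π2) (S1 ×ˢ S2))
    (hcc1 : ∀ s2 ∈ S2, ConcaveOn ℝ S1 (fun t => π1 t s2))
    (hcc2 : ∀ s1 ∈ S1, ConcaveOn ℝ S2 (fun t => π2 s1 t))
    (ψ1 : F → F) (ψ2 : E → E) (s1 : E) (s2 : F)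
    (h : WeakBBE S1 S2 π1 π2 ψ1 ψ2 s1 s2) :
    (Undominated1 S1 S2 π1 s1 ∧ Undominated2 S1 S2 π2 s2) ∧
    M1U S1 S2 π1 π2 ≤ π1 s1 s2 ∧ M2U S1 S2 π1 π2 ≤ π2 s1 s2 := by
  obtain ⟨⟨hm1, hc1⟩, ⟨hm2, hc2⟩, ⟨hs1, hs2, hb1, hb2⟩, hd1, hd2⟩ := h
  refine ⟨⟨⟨ψ1 s2, hm1 hs2, hs1, hb1⟩, ⟨ψ2 s1, hm2 hs1, hs2, hb2⟩⟩, ?_, ?_⟩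
  · obtain ⟨a, b, ⟨ha, hb, h1, h2⟩, hle⟩ := hd1 id ⟨fun x hx => hx, continuousOn_id⟩
    refine le_trans ?_ hle
    exact minmax_aux S1 S2 {s2 | Undominated2 S1 S2 π2 s2} hcp1 hcp2 hne1 (fun y ⟨_, _, hy⟩ => hy.1) π1 hct1 a b
      ⟨ψ2 a, hm2 ha, hb, h2⟩ h1
  · obtain ⟨a, b, ⟨ha, hb, h1, h2⟩, hle⟩ := hd2 id ⟨fun x hx => hx, continuousOn_id⟩
    refine le_trans ?_ hle
    refine minmax_aux S2 S1 {s1 | Undominated1 S1 S2 π1 s1} hcp2 hcp1 hne2 (fun y ⟨_, _, hy⟩ => hy.1)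
      (fun y x => π2 x y) ?_ b a ⟨ψ1 b, hm1 hb, ha, h1⟩ h2
    exact hct2.comp continuous_swap.continuousOn (fun p hp => ⟨hp.2, hp.1⟩)
end

section
/- Let G be a two-player game and fix a player i with opponent j. Suppose s_i* ∈ S_i^U is an undominated Stackelberg strategy: sup{ π_i(s_i*, s_j) : s_j ∈ BR(s_i*) } ≥ sup{ π_i(s'_i, s_j) : s_j ∈ BR(s'_i) } for every s'_i ∈ S_i^U; and suppose s_j* ∈ BR(s_i*) maximizes s_j ↦ π_i(s_i*, s_j) over BR(s_i*). Then there exists a constant (blind) biased belief ψ_i* for player i such that, with player j holding the undistorted identity belief Id on S_i, the pair ((ψ_i*, Id), (s_i*, s_j*)) is a weak BBE, and moreover for each player k ∈ {i, j} and each biased belief ψ'_k of player k there exists a plausible Nash equilibrium (s'_k, s'_l) of the biased game in which player k has belief ψ'_k and the other player keeps his equilibrium belief, with π_k(s'_k, s'_l) ≤ π_k(s_i*, s_j*). -/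
open Set

namespace ScarfAux

def Dom {A I : Type*} (r : I → A → ℕ) (s : Finset A) : Prop :=
  ∀ y, ∃ i, ∀ x ∈ s, r i y ≤ r i x

/-- structure of a one-point extension -/
lemma pivot1 {A I : Type*} [Fintype I] [DecidableEq A] [DecidableEq I]
    (r : I → A → ℕ) (hr : ∀ i, Function.Injective (r i))
    (τ : Finset A) (hcard : τ.card + 1 = Fintype.card I)
    (m : I → A) (hm : ∀ k, m k ∈ τ) (hmin : ∀ k, ∀ x ∈ τ, r k (m k) ≤ r k x)
    (x : A) (hx : x ∉ τ) (hV : Dom r (insert x τ)) :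
    ∃ i, (∀ k, k ≠ i → r k (m k) < r k x) ∧ r i x < r i (m i) ∧
      (∀ y, (∀ k, k ≠ i → r k (m k) < r k y) → r i y ≤ r i x) ∧
      (∀ k l, k ≠ i → l ≠ i → m k = m l → k = l) ∧
      (∃ j, j ≠ i ∧ m j = m i) := by
  classical
  have h1 : ∀ y : {y // y ∈ insert x τ}, ∃ i, ∀ z ∈ insert x τ, r i y ≤ r i z := fun y => hV y
  choose g hg using h1
  have ginj : Function.Injective g := by
    intro y z h
    have a := hg y z z.2
    have b := hg z y y.2
    rw [h] at a
    rw [← h] at b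
    rw [h] at b
    exact Subtype.ext (hr _ (le_antisymm a b))
  have gbij : Function.Bijective g := by
    rw [Fintype.bijective_iff_injective_and_card]
    refine ⟨ginj, ?_⟩
    rw [Fintype.card_coe, Finset.card_insert_of_notMem hx, hcard]
  have hxm : x ∈ insert x τ := Finset.mem_insert_self _ _
  -- for `y ∈ τ`, m (g y) = y
  have hmg : ∀ (y : A) (hy : y ∈ τ), m (g ⟨y, Finset.mem_insert_of_mem hy⟩) = y := by
    intro y hy
    apply hr (g ⟨y, Finset.mem_insert_of_mem hy⟩)
    apply le_antisymm
    · exact hmin _ y hy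
    · exact hg ⟨y, Finset.mem_insert_of_mem hy⟩ _ (Finset.mem_insert_of_mem (hm _))
  have hk : ∀ k, k ≠ g ⟨x, hxm⟩ → ∃ y, ∃ hy : y ∈ τ, g ⟨y, Finset.mem_insert_of_mem hy⟩ = k := by
    intro k hk
    obtain ⟨⟨y, hy⟩, hyk⟩ := gbij.2 k
    rcases Finset.mem_insert.1 hy with h | h
    · subst h; exact absurd hyk.symm hk
    · exact ⟨y, h, hyk⟩
  have hlt : ∀ k, k ≠ g ⟨x, hxm⟩ → r k (m k) < r k x := by
    intro k hk'
    obtain ⟨y, hy, rfl⟩ := hk k hk'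
    rw [hmg y hy]
    refine lt_of_le_of_ne (hg ⟨y, Finset.mem_insert_of_mem hy⟩ x hxm) ?_
    intro h
    exact hx (hr _ h ▸ hy)
  refine ⟨g ⟨x, hxm⟩, hlt, ?_, ?_, ?_, ?_⟩
  · refine lt_of_le_of_ne (hg ⟨x, hxm⟩ _ (Finset.mem_insert_of_mem (hm _))) ?_
    intro h
    exact hx (by rw [hr _ h]; exact hm _)
  · intro y hy
    obtain ⟨i, hi⟩ := hV y
    by_cases h : i = g ⟨x, hxm⟩
    · rw [← h]; exact hi x hxm
    · exact absurd (hi _ (Finset.mem_insert_of_mem (hm i))) (not_le.2 (hy i h))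
  · intro k l h1 h2 h
    obtain ⟨y, hy, rfl⟩ := hk k h1
    obtain ⟨z, hz, rfl⟩ := hk l h2
    rw [hmg y hy, hmg z hz] at h
    subst h; rfl
  · refine ⟨g ⟨m (g ⟨x, hxm⟩), Finset.mem_insert_of_mem (hm _)⟩, ?_, hmg _ (hm _)⟩
    intro h
    have := ginj h
    simp only [Subtype.mk.injEq] at this
    exact hx (this ▸ hm _)

lemma pivot2 {A I : Type*} [Fintype I] [Fintype A] [DecidableEq A] [DecidableEq I]
    (r : I → A → ℕ) (hr : ∀ i, Function.Injective (r i))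
    (d : I → A) (P : A → Prop)
    (hd2 : ∀ i j z, i ≠ j → P z → r i z < r i (d j))
    (τ : Finset A) (hcard : τ.card + 1 = Fintype.card I)
    (z : A) (hz : z ∈ τ) (hPz : P z)
    (X : Finset A) (hX : ∀ x, x ∈ X ↔ x ∉ τ ∧ Dom r (insert x τ)) :
    Even X.card := by
  classical
  rcases X.eq_empty_or_nonempty with h0 | ⟨x0, hx0⟩
  · simp [h0]
  have hne : τ.Nonempty := ⟨z, hz⟩
  have := fun k => Finset.exists_min_image τ (r k) hne
  choose m hm hmin using this
  obtain ⟨hx0t, hV0⟩ := (hX x0).1 hx0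
  obtain ⟨i, a1, a2, a3, a4, j, hji, hmj⟩ := pivot1 r hr τ hcard m hm hmin x0 hx0t hV0
  have hdj : m j ≠ d j := by
    intro h
    have h1 := hd2 i j z (Ne.symm hji) hPz
    have h2 := hmin i z hz
    rw [← hmj, h] at h2
    omega
  let M : Finset A := Finset.univ.filter (fun y => ∀ k, k ≠ j → r k (m k) < r k y)
  have hMd : d j ∈ M := by
    simp only [M, Finset.mem_filter, Finset.mem_univ, true_and]
    intro k hk
    exact lt_of_le_of_lt (hmin k z hz) (hd2 k j z hk hPz)
  obtain ⟨x1, hx1, hx1max⟩ := Finset.exists_max_image M (r j) ⟨_, hMd⟩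
  have hx1' : ∀ k, k ≠ j → r k (m k) < r k x1 := by simpa [M] using hx1
  have hx1j : r j x1 ≤ r j (m j) := by
    by_contra hcon
    push Not at hcon
    obtain ⟨k, hk⟩ := hV0 x1
    have := hk (m k) (Finset.mem_insert_of_mem (hm k))
    by_cases h : k = j
    · subst h; omega
    · have := hx1' k h; omega
  have hx1t : x1 ∉ τ := by
    intro hx
    -- x1 = m j, but m j = m i
    have e : x1 = m j := hr j (le_antisymm hx1j (hmin j _ hx))
    have := hx1' i (Ne.symm hji)
    rw [e, hmj] at this
    omega
  have hV1 : Dom r (insert x1 τ) := by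
    intro y
    by_cases hy : y ∈ M
    · refine ⟨j, fun x hx => ?_⟩
      have h1 := hx1max y hy
      rcases Finset.mem_insert.1 hx with h | h
      · subst h; exact h1
      · have := hmin j x h; omega
    · have : ∃ k, k ≠ j ∧ r k y ≤ r k (m k) := by simpa [M] using hy
      obtain ⟨k, hk, hky⟩ := this
      refine ⟨k, fun x hx => ?_⟩
      rcases Finset.mem_insert.1 hx with h | h
      · subst h; have := hx1' k hk; omega
      · have := hmin k x h; omega
  have hne01 : x0 ≠ x1 := by
    intro h
    have := hx1' i (Ne.symm hji)
    rw [← h] at this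
    omega
  have : X = {x0, x1} := by
    ext x
    simp only [Finset.mem_insert, Finset.mem_singleton]
    constructor
    · intro hx
      obtain ⟨hxt, hV⟩ := (hX x).1 hx
      obtain ⟨i', b1, b2, b3, b4, -⟩ := pivot1 r hr τ hcard m hm hmin x hxt hV
      by_cases h1 : i' = i
      · subst h1
        left
        exact hr i' (le_antisymm (a3 x b1) (b3 x0 a1))
      by_cases h2 : i' = j
      · subst h2
        right
        exact hr i' (le_antisymm (hx1max x (by simpa [M] using b1)) (b3 x1 hx1'))
      exact absurd (b4 j i (Ne.symm h2) (Ne.symm h1) hmj) hji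
    · rintro (h | h)
      · subst h; exact hx0
      · subst h; exact (hX x).2 ⟨hx1t, hV1⟩
  rw [this, Finset.card_pair hne01]
  exact even_two

lemma pivot0 {A I : Type*} [Fintype I] [Fintype A] [DecidableEq A] [DecidableEq I]
    (r : I → A → ℕ) (hr : ∀ i, Function.Injective (r i))
    (d : I → A) (P : A → Prop) (hP : ∀ x, P x ∨ ∃ i, x = d i)
    (hd0 : ∀ i x, P x → r i (d i) < r i x)
    (hd1 : ∀ i x, r i (d i) ≤ r i x)
    (hd2 : ∀ i j z, i ≠ j → P z → r i z < r i (d j))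
    (hPne : ∃ z, P z) (i0 : I)
    (X : Finset A) (hX : ∀ x, x ∈ X ↔ x ∉ (Finset.univ.erase i0).image d ∧
      Dom r (insert x ((Finset.univ.erase i0).image d))) :
    X.card = 1 := by
  classical
  obtain ⟨z, hz⟩ := hPne
  obtain ⟨x0, hx0, hmax⟩ := Finset.exists_max_image (Finset.univ.filter P) (r i0)
    ⟨z, by simpa using hz⟩
  have hx0P : P x0 := by simpa using hx0
  have hmax' : ∀ y, P y → r i0 y ≤ r i0 x0 := fun y hy => hmax y (by simpa using hy)
  have key : ∀ x, Dom r (insert x ((Finset.univ.erase i0).image d)) →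
      ∀ y, P y → r i0 y ≤ r i0 x := by
    intro x hV y hy
    obtain ⟨k, hk⟩ := hV y
    by_cases h : k = i0
    · subst h; exact hk x (Finset.mem_insert_self _ _)
    · have := hk (d k) (Finset.mem_insert_of_mem (Finset.mem_image_of_mem _ (by simpa using h)))
      have := hd0 k y hy
      omega
  rw [Finset.card_eq_one]
  refine ⟨x0, ?_⟩
  ext x
  rw [Finset.mem_singleton]
  constructor
  · intro hx
    obtain ⟨hxt, hV⟩ := (hX x).1 hx
    have hk := key x hV
    rcases hP x with h | ⟨i, rfl⟩
    · exact hr i0 (le_antisymm (hmax' x h) (hk x0 hx0P))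
    · by_cases h : i = i0
      · subst h
        have := hk x0 hx0P
        have := hd0 i x0 hx0P
        omega
      · exact absurd (Finset.mem_image_of_mem _ (by simpa using h)) hxt
  · rintro rfl
    refine (hX x).2 ⟨?_, ?_⟩
    · intro h
      obtain ⟨j, -, rfl⟩ := Finset.mem_image.1 h
      exact lt_irrefl _ (hd0 j _ hx0P)
    · intro y
      rcases hP y with h | ⟨i, rfl⟩
      · refine ⟨i0, fun u hu => ?_⟩
        rcases Finset.mem_insert.1 hu with h' | h'
        · subst h'; exact hmax' y h
        · obtain ⟨j, hj, rfl⟩ := Finset.mem_image.1 h'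
          have : j ≠ i0 := by simpa using hj
          exact (hd2 i0 j y this.symm h).le
      · exact ⟨i, fun u _ => hd1 i u⟩


lemma room_even {A I : Type*} [Fintype I] [DecidableEq A] [DecidableEq I]
    (c : A → I) (i0 : I) (σ : Finset A) (hcard : σ.card = Fintype.card I)
    (hnot : σ.image c ≠ Finset.univ) :
    Even (σ.filter (fun x => (σ.erase x).image c = Finset.univ.erase i0)).card := by
  classical
  set Y := σ.filter (fun x => (σ.erase x).image c = Finset.univ.erase i0) with hY
  rcases Y.eq_empty_or_nonempty with h0 | ⟨x0, hx0⟩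
  · simp [h0]
  have memY : ∀ x, x ∈ Y ↔ x ∈ σ ∧ (σ.erase x).image c = Finset.univ.erase i0 := by
    intro x; simp [hY]
  have inj : ∀ x ∈ Y, Set.InjOn c (σ.erase x : Finset A) := by
    intro x hx
    obtain ⟨h1, h2⟩ := (memY x).1 hx
    apply Finset.card_image_iff.1
    rw [h2, Finset.card_erase_of_mem h1, Finset.card_erase_of_mem (Finset.mem_univ _), hcard,
      Finset.card_univ]
  obtain ⟨h1, h2⟩ := (memY x0).1 hx0
  have hc0 : c x0 ≠ i0 := by
    intro h
    apply hnot
    rw [← Finset.insert_erase h1, Finset.image_insert, h2, h,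
      Finset.insert_erase (Finset.mem_univ _)]
  have : c x0 ∈ (σ.erase x0).image c := by rw [h2]; simpa using hc0
  obtain ⟨x1, hx1, hc1⟩ := Finset.mem_image.1 this
  obtain ⟨hx10, hx1σ⟩ := Finset.mem_erase.1 hx1
  have hYe : Y = {x0, x1} := by
    ext x
    simp only [Finset.mem_insert, Finset.mem_singleton]
    constructor
    · intro hx
      by_contra hcon
      push Not at hcon
      have := @inj x hx x0 (by simp [h1, hcon.1.symm]) x1
        (by simp [hx1σ, hcon.2.symm]) hc1.symm
      exact hx10 this.symm
    · rintro (h | h)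
      · subst h; exact hx0
      · subst h
        refine (memY x).2 ⟨hx1σ, ?_⟩
        rw [← h2]
        ext i
        simp only [Finset.mem_image, Finset.mem_erase]
        constructor
        · rintro ⟨a, ⟨ha, ha'⟩, rfl⟩
          by_cases hax : a = x0
          · subst hax; exact ⟨x, ⟨hx10, hx1σ⟩, hc1⟩
          · exact ⟨a, ⟨hax, ha'⟩, rfl⟩
        · rintro ⟨a, ⟨ha, ha'⟩, rfl⟩
          by_cases hax : a = x
          · subst hax; exact ⟨x0, ⟨hx10.symm, h1⟩, hc1.symm⟩
          · exact ⟨a, ⟨hax, ha'⟩, rfl⟩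
  rw [hYe, Finset.card_pair hx10.symm]
  exact even_two

lemma scarf {A I : Type*} [Fintype I] [Fintype A] [DecidableEq A] [DecidableEq I]
    (r : I → A → ℕ) (hr : ∀ i, Function.Injective (r i))
    (d : I → A) (P : A → Prop) (hP : ∀ x, P x ∨ ∃ i, x = d i)
    (hd0 : ∀ i x, P x → r i (d i) < r i x)
    (hd1 : ∀ i x, r i (d i) ≤ r i x)
    (hd2 : ∀ i j z, i ≠ j → P z → r i z < r i (d j))
    (hPne : ∃ z, P z) (i0 : I) (c : A → I) (hc : ∀ i, c (d i) = i) :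
    ∃ σ : Finset A, Dom r σ ∧ σ.card = Fintype.card I ∧ σ.image c = Finset.univ := by
  classical
  by_contra hcon
  push Not at hcon
  let D : Finset (Finset A) := Finset.univ.filter (fun τ => τ.image c = Finset.univ.erase i0 ∧
    τ.card + 1 = Fintype.card I)
  let R : Finset (Finset A) := Finset.univ.filter (fun σ => Dom r σ ∧ σ.card = Fintype.card I)
  let X : Finset A → Finset A := fun τ => Finset.univ.filter
    (fun x => x ∉ τ ∧ Dom r (insert x τ))
  let Y : Finset A → Finset A := fun σ => σ.filter
    (fun x => (σ.erase x).image c = Finset.univ.erase i0)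
  have hX : ∀ τ x, x ∈ X τ ↔ x ∉ τ ∧ Dom r (insert x τ) := by intro τ x; simp [X]
  have e1 : (D.sigma X).card = (R.sigma Y).card := by
    refine Finset.card_nbij' (fun p => ⟨insert p.2 p.1, p.2⟩) (fun p => ⟨p.1.erase p.2, p.2⟩)
      ?_ ?_ ?_ ?_
    · rintro ⟨τ, x⟩ h
      simp only [D, X, Finset.coe_sigma, Set.mem_sigma_iff, Finset.mem_coe, Finset.mem_filter,
        Finset.mem_univ, true_and] at h
      obtain ⟨⟨h1, h2⟩, h3, h4⟩ := h
      simp only [R, Y, Finset.coe_sigma, Set.mem_sigma_iff, Finset.mem_coe, Finset.mem_filter,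
        Finset.mem_univ, true_and]
      refine ⟨⟨h4, ?_⟩, Finset.mem_insert_self _ _, ?_⟩
      · rw [Finset.card_insert_of_notMem h3, h2]
      · rw [Finset.erase_insert h3, h1]
    · rintro ⟨σ, x⟩ h
      simp only [R, Y, Finset.coe_sigma, Set.mem_sigma_iff, Finset.mem_coe, Finset.mem_filter,
        Finset.mem_univ, true_and] at h
      obtain ⟨⟨h1, h2⟩, h3, h4⟩ := h
      simp only [D, X, Finset.coe_sigma, Set.mem_sigma_iff, Finset.mem_coe, Finset.mem_filter,
        Finset.mem_univ, true_and]
      refine ⟨⟨h4, ?_⟩, Finset.notMem_erase _ _, ?_⟩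
      · rw [Finset.card_erase_add_one h3, h2]
      · rw [Finset.insert_erase h3]; exact h1
    · rintro ⟨τ, x⟩ h
      simp only [D, X, Finset.coe_sigma, Set.mem_sigma_iff, Finset.mem_coe, Finset.mem_filter,
        Finset.mem_univ, true_and] at h
      simp [Finset.erase_insert h.2.1]
    · rintro ⟨σ, x⟩ h
      simp only [R, Y, Finset.coe_sigma, Set.mem_sigma_iff, Finset.mem_coe, Finset.mem_filter,
        Finset.mem_univ, true_and] at h
      simp [Finset.insert_erase h.2.1]
  rw [Finset.card_sigma, Finset.card_sigma] at e1
  have hE : Even (∑ σ ∈ R, (Y σ).card) := by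
    apply Finset.even_sum
    intro σ hσ
    have hσ' : Dom r σ ∧ σ.card = Fintype.card I := by simpa [R] using hσ
    exact room_even c i0 σ hσ'.2 (hcon σ hσ'.1 hσ'.2)
  have hdinj : Function.Injective d := Function.LeftInverse.injective hc
  let τ0 : Finset A := (Finset.univ.erase i0).image d
  have hcard0 : τ0.card + 1 = Fintype.card I := by
    rw [Finset.card_image_of_injective _ hdinj, Finset.card_erase_add_one (Finset.mem_univ _),
      Finset.card_univ]
  have hτ0 : τ0 ∈ D := by
    simp only [D, Finset.mem_filter, Finset.mem_univ, true_and]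
    refine ⟨?_, hcard0⟩
    rw [Finset.image_image]
    have : c ∘ d = id := funext hc
    rw [this, Finset.image_id]
  have h1 : (X τ0).card = 1 :=
    pivot0 r hr d P hP hd0 hd1 hd2 hPne i0 (X τ0) (hX τ0)
  have h2 : Even (∑ τ ∈ D.erase τ0, (X τ).card) := by
    apply Finset.even_sum
    intro τ hτ
    obtain ⟨hne, hτD⟩ := Finset.mem_erase.1 hτ
    simp only [D, Finset.mem_filter, Finset.mem_univ, true_and] at hτD
    have : ∃ z ∈ τ, P z := by
      by_contra hno
      push Not at hno
      apply hne
      apply Finset.eq_of_subset_of_card_le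
      · intro x hx
        rcases hP x with h | ⟨i, rfl⟩
        · exact absurd h (hno x hx)
        · apply Finset.mem_image_of_mem
          rw [← hτD.1]
          exact Finset.mem_image.2 ⟨_, hx, hc i⟩
      · omega
    obtain ⟨z, hz, hPz⟩ := this
    exact pivot2 r hr d P hd2 τ hτD.2 z hz hPz (X τ) (hX τ)
  rw [← Finset.add_sum_erase D _ hτ0, h1] at e1
  rw [← e1] at hE
  rw [add_comm, Nat.even_add_one] at hE
  exact hE h2

/-- combinatorial lemma on the grid -/
lemma grid {I : Type*} [Fintype I] [DecidableEq I] [Nonempty I] (m : ℕ)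
    (c : (I → ℕ) → I) :
    ∃ (C : Finset I) (p : I → I → ℕ), C.Nonempty ∧
      (∀ i ∈ C, ∑ k, p i k = m ∧ c (p i) = i) ∧
      (∀ i ∈ C, ∀ j ∈ C, ∀ k, p i k ≤ p j k + Fintype.card I) ∧
      (∀ i ∈ C, ∀ k, k ∉ C → p i k ≤ Fintype.card I) := by
  classical
  let T := {x : I → ℕ // x ∈ Finset.piAntidiag Finset.univ m}
  have hT : ∀ x : T, ∑ k, x.1 k = m := fun x => (Finset.mem_piAntidiag.1 x.2).1
  have mkT : ∀ x : I → ℕ, ∑ k, x k = m → x ∈ Finset.piAntidiag Finset.univ m := by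
    intro x hx; simp [Finset.mem_piAntidiag, hx]
  let _ : Fintype T := Finset.Subtype.fintype _
  let N := Fintype.card T
  let e := Fintype.equivFin T
  let e' := Fintype.equivFin I
  let B := (m + 1) * N + 1
  let r : I → T ⊕ I → ℕ := fun i a => match a with
    | Sum.inl x => 1 + (x.1 i * N + e x)
    | Sum.inr j => if j = i then 0 else B + e' j
  have hle : ∀ (x : T) i, x.1 i ≤ m := by
    intro x i
    exact (Finset.single_le_sum (f := x.1) (fun _ _ => Nat.zero_le _) (Finset.mem_univ i)).trans
      (hT x).le
  have hB : ∀ i (x : T), r i (Sum.inl x) < B := by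
    intro i x
    have h1 : (e x : ℕ) < N := (e x).2
    have h2 : x.1 i * N ≤ m * N := Nat.mul_le_mul_right _ (hle x i)
    simp only [r, B, add_mul, one_mul]
    omega
  have hrr : ∀ i (x : T), r i (Sum.inl x) = 1 + (x.1 i * N + e x) := fun _ _ => rfl
  have hrd : ∀ i j, r i (Sum.inr j) = if j = i then 0 else B + e' j := fun _ _ => rfl
  have hr : ∀ i, Function.Injective (r i) := by
    rintro i (x | j) (y | k) h
    · rw [hrr, hrr] at h
      have h1 : (e x : ℕ) < N := (e x).2
      have h2 : (e y : ℕ) < N := (e y).2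
      have h3 : (x.1 i * N + e x) % N = (y.1 i * N + e y) % N := by
        congr 1; omega
      rw [Nat.mul_add_mod', Nat.mul_add_mod', Nat.mod_eq_of_lt h1, Nat.mod_eq_of_lt h2] at h3
      rw [e.injective (Fin.ext h3)]
    · have := hB i x
      have := hrr i x
      rw [hrd] at h
      split_ifs at h <;> omega
    · have := hB i y
      have := hrr i y
      rw [hrd] at h
      split_ifs at h <;> omega
    · rw [hrd, hrd] at h
      split_ifs at h with h1 h2 h2
      · rw [h1, h2]
      · omega
      · omega
      · rw [e'.injective (Fin.ext (by omega : (e' j : ℕ) = e' k))]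
  let i0 : I := Classical.arbitrary I
  let z0 : T := ⟨Pi.single i0 m, mkT _ (by simp)⟩
  let c' : T ⊕ I → I := Sum.elim (fun x => c x.1) id
  obtain ⟨σ, hdom, hcard, himg⟩ := scarf r hr Sum.inr (fun a => ∃ x, a = Sum.inl x)
    (by rintro (x | j)
        · exact Or.inl ⟨x, rfl⟩
        · exact Or.inr ⟨j, rfl⟩)
    (by rintro i _ ⟨x, rfl⟩
        rw [hrd, hrr]; simp)
    (by intro i x; rw [hrd]; simp)
    (by rintro i j _ hij ⟨x, rfl⟩
        have := hB i x
        rw [hrd, if_neg (Ne.symm hij)]; omega)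
    ⟨Sum.inl z0, z0, rfl⟩ i0 c' (fun i => rfl)
  let C : Finset I := Finset.univ.filter (fun i => Sum.inr i ∉ σ)
  have hC : ∀ i, i ∈ C ↔ Sum.inr i ∉ σ := by intro i; simp [C]
  have hdomT : ∀ y : T, ∃ i ∈ C, ∀ x : T, Sum.inl x ∈ σ → y.1 i ≤ x.1 i := by
    intro y
    obtain ⟨i, hi⟩ := hdom (Sum.inl y)
    refine ⟨i, ?_, ?_⟩
    · rw [hC]
      intro h
      have := hi _ h
      rw [hrd, hrr] at this
      simp at this
    · intro x hx
      have h := hi _ hx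
      rw [hrr, hrr] at h
      have h2 : (e x : ℕ) < N := (e x).2
      by_contra hlt
      push Not at hlt
      have : (x.1 i + 1) * N ≤ y.1 i * N := Nat.mul_le_mul_right _ hlt
      rw [add_mul] at this
      omega
  have hCne : C.Nonempty := by
    obtain ⟨i, hi, -⟩ := hdomT z0
    exact ⟨i, hi⟩
  have hp : ∀ i, ∃ x : T, i ∈ C → Sum.inl x ∈ σ ∧ c x.1 = i := by
    intro i
    by_cases hi : i ∈ C
    · have : i ∈ σ.image c' := by rw [himg]; exact Finset.mem_univ _
      obtain ⟨a, ha, hca⟩ := Finset.mem_image.1 this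
      rcases a with x | j
      · exact ⟨x, fun _ => ⟨ha, hca⟩⟩
      · have : j = i := hca
        subst this
        exact absurd ha ((hC j).1 hi)
    · exact ⟨z0, fun h => absurd h hi⟩
  choose p hp using hp
  let S : Finset T := Finset.univ.filter (fun x => Sum.inl x ∈ σ)
  have hS : ∀ x, x ∈ S ↔ Sum.inl x ∈ σ := by intro x; simp [S]
  have hSne : S.Nonempty := by
    obtain ⟨i, hi⟩ := hCne
    exact ⟨p i, (hS _).2 (hp i hi).1⟩
  have := fun k : I => Finset.exists_min_image S (fun x => x.1 k) hSne
  choose q hqS hq using this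
  let Q : I → ℕ := fun k => (q k).1 k
  have hQ : ∀ k, ∀ x ∈ S, Q k ≤ x.1 k := hq
  have hsum : m < ∑ k ∈ C, (Q k + 1) := by
    by_contra hcon
    push Not at hcon
    obtain ⟨j, hj⟩ := hCne
    let y : I → ℕ := fun k => (if k ∈ C then Q k + 1 else 0) +
      (if k = j then m - ∑ k ∈ C, (Q k + 1) else 0)
    have hy : ∑ k, y k = m := by
      simp only [y, Finset.sum_add_distrib]
      rw [Finset.sum_ite_mem, Finset.sum_ite_eq' Finset.univ j]
      simp only [Finset.univ_inter, Finset.mem_univ, if_true, Finset.sum_add_distrib] at hcon ⊢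
      omega
    obtain ⟨i, hi, h⟩ := hdomT ⟨y, mkT y hy⟩
    have := h (q i) ((hS _).1 (hqS i))
    simp only [y, if_pos hi] at this
    have hQi : Q i = (q i).1 i := rfl
    omega
  have hCc : C.card ≤ Fintype.card I := Finset.card_le_univ C
  have hsum' : m < ∑ k ∈ C, Q k + C.card := by
    simpa [Finset.sum_add_distrib] using hsum
  -- main bound
  have hb1 : ∀ x ∈ S, ∀ k ∈ C, x.1 k ≤ Q k + Fintype.card I := by
    intro x hx k hk
    have h1 : ∑ l ∈ C, x.1 l ≤ m := by
      exact (Finset.sum_le_sum_of_subset (Finset.subset_univ C)).trans (hT x).le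
    have h2 : ∑ l ∈ C.erase k, Q l ≤ ∑ l ∈ C.erase k, x.1 l :=
      Finset.sum_le_sum (fun l _ => hQ l x hx)
    rw [← Finset.add_sum_erase C _ hk] at h1 hsum'
    omega
  have hb2 : ∀ x ∈ S, ∀ k, k ∉ C → x.1 k ≤ Fintype.card I := by
    intro x hx k hk
    have h1 : ∑ l ∈ insert k C, x.1 l ≤ m := by
      exact (Finset.sum_le_sum_of_subset (Finset.subset_univ _)).trans (hT x).le
    have h2 : ∑ l ∈ C, Q l ≤ ∑ l ∈ C, x.1 l :=
      Finset.sum_le_sum (fun l _ => hQ l x hx)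
    rw [Finset.sum_insert hk] at h1
    omega
  have hpS : ∀ i ∈ C, p i ∈ S := fun i hi => (hS _).2 (hp i hi).1
  refine ⟨C, fun i => (p i).1, hCne, ?_, ?_, ?_⟩
  · intro i hi
    exact ⟨hT _, (hp i hi).2⟩
  · intro i hi j hj k
    change (p i).1 k ≤ (p j).1 k + _
    by_cases hk : k ∈ C
    · have := hb1 _ (hpS i hi) k hk
      have := hQ k _ (hpS j hj)
      omega
    · have := hb2 _ (hpS i hi) k hk
      omega
  · intro i hi k hk
    exact hb2 _ (hpS i hi) k hk

lemma brouwer_approx {I : Type*} [Fintype I] [Nonempty I]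
    (f : (I → ℝ) → (I → ℝ)) (hf : ContinuousOn f (stdSimplex ℝ I))
    (hm : Set.MapsTo f (stdSimplex ℝ I) (stdSimplex ℝ I)) (ε : ℝ) (hε : 0 < ε) :
    ∃ x ∈ stdSimplex ℝ I, ∀ i, x i - f x i ≤ ε := by
  classical
  have huc := (isCompact_stdSimplex ℝ I).uniformContinuousOn_of_continuous hf
  rw [Metric.uniformContinuousOn_iff] at huc
  obtain ⟨δ, hδ, huc⟩ := huc (ε / 2) (by positivity)
  obtain ⟨n, hnn⟩ : ∃ n : ℝ, n = Fintype.card I := ⟨_, rfl⟩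
  have hn : 0 ≤ n := hnn ▸ Nat.cast_nonneg _
  obtain ⟨m0, hm0⟩ := exists_nat_gt (n / min δ (ε / 2))
  have hmin : 0 < min δ (ε / 2) := lt_min hδ (by positivity)
  have hmpos : (0 : ℝ) < m0 := lt_of_le_of_lt (by positivity) hm0
  have hnm : n / m0 < min δ (ε / 2) := by
    rw [div_lt_iff₀ hmin] at hm0
    rw [div_lt_iff₀ hmpos]; linarith
  have hnδ : n / m0 < δ := lt_of_lt_of_le hnm (min_le_left _ _)
  have hnε : n / m0 < ε / 2 := lt_of_lt_of_le hnm (min_le_right _ _)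
  let s : (I → ℕ) → (I → ℝ) := fun x i => (x i : ℝ) / m0
  have hs : ∀ x : I → ℕ, ∑ k, x k = m0 → s x ∈ stdSimplex ℝ I := by
    intro x hx
    refine ⟨fun i => by positivity, ?_⟩
    simp only [s]
    rw [← Finset.sum_div, ← Nat.cast_sum, hx, div_self hmpos.ne']
  have hex : ∀ x : I → ℕ, ∃ i, ∑ k, x k = m0 → s x i ≤ f (s x) i := by
    intro x
    by_cases hx : ∑ k, x k = m0
    · by_contra hcon
      push Not at hcon
      have h1 := (hs x hx).2
      have h2 := (hm (hs x hx)).2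
      have : ∑ i, f (s x) i < ∑ i, s x i :=
        Finset.sum_lt_sum_of_nonempty Finset.univ_nonempty (fun i _ => (hcon i).2)
      linarith
    · exact ⟨Classical.arbitrary I, fun h => absurd h hx⟩
  choose c hc using hex
  obtain ⟨C, p, ⟨j, hj⟩, h1, h2, h3⟩ := grid m0 c
  refine ⟨s (p j), hs _ (h1 j hj).1, fun i => ?_⟩
  have hpos := (hm (hs _ (h1 j hj).1)).1 i
  by_cases hi : i ∈ C
  · have hd : dist (s (p j)) (s (p i)) < δ := by
      refine lt_of_le_of_lt ?_ hnδ
      rw [dist_pi_le_iff (by positivity)]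
      intro k
      have a : (p i k : ℝ) ≤ p j k + n := by rw [hnn]; exact_mod_cast h2 i hi j hj k
      have b : (p j k : ℝ) ≤ p i k + n := by rw [hnn]; exact_mod_cast h2 j hj i hi k
      simp only [s]
      rw [Real.dist_eq, ← sub_div, abs_div, abs_of_pos hmpos]
      gcongr
      rw [abs_le]; constructor <;> linarith
    have hfd := huc _ (hs _ (h1 j hj).1) _ (hs _ (h1 i hi).1) hd
    have hfi := lt_of_le_of_lt (dist_le_pi_dist _ _ i) hfd
    have hci := hc (p i) (h1 i hi).1
    rw [(h1 i hi).2] at hci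
    have hji : s (p j) i ≤ s (p i) i + n / m0 := by
      simp only [s]
      rw [← add_div]
      gcongr
      rw [hnn]; exact_mod_cast h2 j hj i hi i
    rw [Real.dist_eq, abs_lt] at hfi
    linarith [hfi.1]
  · have : s (p j) i ≤ n / m0 := by
      simp only [s]
      gcongr
      rw [hnn]; exact_mod_cast h3 j hj i hi
    linarith

lemma brouwer_simplex {I : Type*} [Fintype I] [Nonempty I]
    (f : (I → ℝ) → (I → ℝ)) (hf : ContinuousOn f (stdSimplex ℝ I))
    (hm : Set.MapsTo f (stdSimplex ℝ I) (stdSimplex ℝ I)) :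
    ∃ x ∈ stdSimplex ℝ I, f x = x := by
  classical
  let g : (I → ℝ) → ℝ := fun x => ∑ i, max (x i - f x i) 0
  have hg : ContinuousOn g (stdSimplex ℝ I) := by
    apply continuousOn_finsetSum
    intro i _
    have h1 : ContinuousOn (fun x => f x i) (stdSimplex ℝ I) :=
      (continuous_apply i).comp_continuousOn hf
    have h2 : ContinuousOn (fun x : I → ℝ => x i) (stdSimplex ℝ I) :=
      (continuous_apply i).continuousOn
    exact (h2.sub h1).sup continuousOn_const
  obtain ⟨x0, hx0, -⟩ := brouwer_approx f hf hm 1 one_pos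
  obtain ⟨x, hx, hmin⟩ := (isCompact_stdSimplex ℝ I).exists_isMinOn ⟨x0, hx0⟩ hg
  refine ⟨x, hx, ?_⟩
  have hle : g x ≤ 0 := by
    apply le_of_forall_pos_le_add
    intro ε hε
    have hn : (0 : ℝ) < Fintype.card I := by exact_mod_cast Fintype.card_pos
    obtain ⟨y, hy, hye⟩ := brouwer_approx f hf hm (ε / Fintype.card I) (by positivity)
    have h1 : g x ≤ g y := hmin hy
    have h2 : g y ≤ ∑ _i : I, ε / Fintype.card I :=
      Finset.sum_le_sum (fun i _ => max_le (hye i) (by positivity))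
    have h3 : ∑ _i : I, ε / Fintype.card I = ε := by
      rw [Finset.sum_const, Finset.card_univ, nsmul_eq_mul]
      field_simp
    linarith
  have hxi : ∀ i, x i ≤ f x i := by
    intro i
    have h1 : max (x i - f x i) 0 ≤ g x :=
      Finset.single_le_sum (f := fun i => max (x i - f x i) 0) (fun _ _ => le_max_right _ _)
        (Finset.mem_univ i)
    have := le_max_left (x i - f x i) 0
    linarith
  have hsum : ∑ i, x i = ∑ i, f x i := by rw [hx.2, (hm hx).2]
  have := (Finset.sum_eq_sum_iff_of_le (fun i _ => hxi i)).1 hsum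
  funext i
  exact (this i (Finset.mem_univ i)).symm

lemma ky_fan {V : Type*} [NormedAddCommGroup V] [NormedSpace ℝ V]
    (K : Set V) (hne : K.Nonempty) (hK : IsCompact K) (hcv : Convex ℝ K)
    (f : V → V → ℝ) (hf : ∀ y ∈ K, ContinuousOn (fun x => f x y) K)
    (hcc : ∀ x ∈ K, ConcaveOn ℝ K (f x)) (h0 : ∀ x ∈ K, f x x ≤ 0) :
    ∃ x ∈ K, ∀ y ∈ K, f x y ≤ 0 := by
  classical
  by_contra hcon
  push Not at hcon
  have : ∀ x, ∃ y, x ∈ K → y ∈ K ∧ 0 < f x y := by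
    intro x
    by_cases hx : x ∈ K
    · obtain ⟨y, hy⟩ := hcon x hx; exact ⟨y, fun _ => hy⟩
    · exact ⟨x, fun h => absurd h hx⟩
  choose Y hY using this
  obtain ⟨t, ht, hcov⟩ := hK.elim_nhdsWithin_subcover (fun x => {x' | 0 < f x' (Y x)})
    (fun x hx => (hf _ (hY x hx).1 x hx).eventually (lt_mem_nhds (hY x hx).2))
  obtain ⟨x0, hx0⟩ := hne
  have hIne : Nonempty t := by
    have := hcov hx0
    simp only [Set.mem_iUnion] at this
    obtain ⟨i, hi, -⟩ := this
    exact ⟨⟨i, hi⟩⟩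
  let y : t → V := fun i => Y i
  have hy : ∀ i, y i ∈ K := fun i => (hY _ (ht i i.2)).1
  let L : (t → ℝ) → V := fun l => ∑ i, l i • y i
  have hL : ∀ l ∈ stdSimplex ℝ t, L l ∈ K := fun l hl =>
    hcv.sum_mem (fun i _ => hl.1 i) hl.2 (fun i _ => hy i)
  have hLc : Continuous L := by
    apply continuous_finsetSum
    intro i _
    exact (continuous_apply i).smul continuous_const
  let w : t → V → ℝ := fun i x => max (f x (y i)) 0
  let W : V → ℝ := fun x => ∑ i, w i x
  have hw0 : ∀ i x, 0 ≤ w i x := fun i x => le_max_right _ _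
  have hwc : ∀ i, ContinuousOn (w i) K := fun i => (hf _ (hy i)).sup continuousOn_const
  have hWc : ContinuousOn W K := continuousOn_finsetSum _ (fun i _ => hwc i)
  have hW : ∀ x ∈ K, 0 < W x := by
    intro x hx
    have := hcov hx
    simp only [Set.mem_iUnion] at this
    obtain ⟨i, hi, h⟩ := this
    refine Finset.sum_pos' (fun i _ => hw0 i x) ⟨⟨i, hi⟩, Finset.mem_univ _, ?_⟩
    exact lt_of_lt_of_le h (le_max_left _ _)
  let g : (t → ℝ) → (t → ℝ) := fun l i => w i (L l) / W (L l)
  have hmaps : Set.MapsTo L (stdSimplex ℝ t) K := hL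
  have hgc : ContinuousOn g (stdSimplex ℝ t) := by
    apply continuousOn_pi.2
    intro i
    exact ((hwc i).comp hLc.continuousOn hmaps).div (hWc.comp hLc.continuousOn hmaps)
      (fun l hl => (hW _ (hL l hl)).ne')
  have hgm : Set.MapsTo g (stdSimplex ℝ t) (stdSimplex ℝ t) := by
    intro l hl
    refine ⟨fun i => div_nonneg (hw0 _ _) (hW _ (hL l hl)).le, ?_⟩
    simp only [g]
    rw [← Finset.sum_div]
    exact div_self (hW _ (hL l hl)).ne'
  obtain ⟨l, hl, hfix⟩ := brouwer_simplex g hgc hgm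
  have hj := (hcc _ (hL l hl)).le_map_sum (t := Finset.univ) (w := l) (p := y)
    (fun i _ => hl.1 i) hl.2 (fun i _ => hy i)
  have h00 := h0 _ (hL l hl)
  have hWp := hW _ (hL l hl)
  have hli : ∀ i, l i = w i (L l) / W (L l) := fun i => (congrFun hfix i).symm
  have hterm : ∀ i, 0 ≤ l i * f (L l) (y i) ∧ (0 < w i (L l) → 0 < l i * f (L l) (y i)) := by
    intro i
    rcases le_or_gt (f (L l) (y i)) 0 with h | h
    · have : w i (L l) = 0 := max_eq_right h
      rw [hli i, this]; simp
    · have : w i (L l) = f (L l) (y i) := max_eq_left h.le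
      have h' : 0 < l i * f (L l) (y i) := by
        rw [hli i, this]; positivity
      exact ⟨h'.le, fun _ => h'⟩
  obtain ⟨i, -, hi⟩ := Finset.exists_lt_of_sum_lt (s := Finset.univ) (f := fun _ : t => (0 : ℝ))
    (g := fun i => w i (L l)) (by rw [Finset.sum_const_zero]; exact hWp)
  have : 0 < ∑ i, l i * f (L l) (y i) :=
    Finset.sum_pos' (fun i _ => (hterm i).1) ⟨i, Finset.mem_univ _, (hterm i).2 hi⟩
  have hj' : ∑ i, l i * f (L l) (y i) ≤ f (L l) (L l) := hj
  linarith

end ScarfAux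

open BBEPaper

lemma exists_biasedNE
    {E F : Type*} [NormedAddCommGroup E] [NormedSpace ℝ E]
    [NormedAddCommGroup F] [NormedSpace ℝ F]
    (S1 : Set E) (S2 : Set F)
    (hne1 : S1.Nonempty) (hcp1 : IsCompact S1) (hcv1 : Convex ℝ S1)
    (hne2 : S2.Nonempty) (hcp2 : IsCompact S2) (hcv2 : Convex ℝ S2)
    (π1 π2 : E → F → ℝ)
    (hct1 : ContinuousOn (Function.uncurry π1) (S1 ×ˢ S2))
    (hct2 : ContinuousOn (Function.uncurry π2) (S1 ×ˢ S2))
    (hcc1 : ∀ s2 ∈ S2, ConcaveOn ℝ S1 (fun t => π1 t s2))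
    (hcc2 : ∀ s1 ∈ S1, ConcaveOn ℝ S2 (fun t => π2 s1 t))
    (ψ : F → F) (hψ : IsBelief S2 ψ) :
    ∃ s1 s2, BiasedNE S1 S2 π1 π2 ψ id s1 s2 := by
  obtain ⟨hψm, hψc⟩ := hψ
  let K : Set (E × F) := S1 ×ˢ S2
  have c1 : ContinuousOn (fun x : E × F => x.1) K := continuousOn_fst
  have c2 : ContinuousOn (fun x : E × F => x.2) K := continuousOn_snd
  have cψ : ContinuousOn (fun x : E × F => ψ x.2) K := hψc.comp c2 (fun x hx => hx.2)
  obtain ⟨x, hx, h⟩ := ScarfAux.ky_fan K (hne1.prod hne2) (hcp1.prod hcp2) (hcv1.prod hcv2)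
    (fun x y => (π1 y.1 (ψ x.2) - π1 x.1 (ψ x.2)) + (π2 x.1 y.2 - π2 x.1 x.2))
    (by
      intro y hy
      have a1 : ContinuousOn (fun x : E × F => π1 y.1 (ψ x.2)) K :=
        hct1.comp (continuousOn_const.prodMk cψ) (fun x hx => ⟨hy.1, hψm hx.2⟩)
      have a2 : ContinuousOn (fun x : E × F => π1 x.1 (ψ x.2)) K :=
        hct1.comp (c1.prodMk cψ) (fun x hx => ⟨hx.1, hψm hx.2⟩)
      have a3 : ContinuousOn (fun x : E × F => π2 x.1 y.2) K :=
        hct2.comp (c1.prodMk continuousOn_const) (fun x hx => ⟨hx.1, hy.2⟩)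
      have a4 : ContinuousOn (fun x : E × F => π2 x.1 x.2) K :=
        hct2.comp (c1.prodMk c2) (fun x hx => hx)
      exact (a1.sub a2).add (a3.sub a4))
    (by
      intro x hx
      refine ⟨hcv1.prod hcv2, ?_⟩
      intro y hy z hz a b ha hb hab
      have h1 := (hcc1 _ (hψm hx.2)).2 hy.1 hz.1 ha hb hab
      have h2 := (hcc2 _ hx.1).2 hy.2 hz.2 ha hb hab
      simp only [smul_eq_mul, Prod.fst_add, Prod.snd_add, Prod.smul_fst, Prod.smul_snd]
        at h1 h2 ⊢
      have hb' : b = 1 - a := by linarith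
      subst hb'
      nlinarith [h1, h2])
    (by intro x _; simp)
  refine ⟨x.1, x.2, hx.1, hx.2, ?_, ?_⟩
  · intro t ht
    have := h (t, x.2) ⟨ht, hx.2⟩
    simp only at this
    linarith
  · intro t ht
    have := h (x.1, t) ⟨hx.1, ht⟩
    simp only [id] at this ⊢
    linarith


/-- Strategic stubbornness: if s1 is an undominated Stackelberg strategy
of player 1 and s2 is the best reply to s1 that is best for player 1, then there is a blind
belief for player 1 such that, with player 2 holding undistorted beliefs, ((ψ1*, Id),
(s1, s2)) is a weak BBE in which every deviation of either player is outperformed in some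
plausible equilibrium of the new biased game. -/
theorem stackelberg_stubbornness_bbe
    {E F : Type*} [NormedAddCommGroup E] [NormedSpace ℝ E] [FiniteDimensional ℝ E]
    [NormedAddCommGroup F] [NormedSpace ℝ F] [FiniteDimensional ℝ F]
    (S1 : Set E) (S2 : Set F)
    (hne1 : S1.Nonempty) (hcp1 : IsCompact S1) (hcv1 : Convex ℝ S1)
    (hne2 : S2.Nonempty) (hcp2 : IsCompact S2) (hcv2 : Convex ℝ S2)
    (π1 π2 : E → F → ℝ)
    (hct1 : ContinuousOn (Function.uncurry π1) (S1 ×ˢ S2))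
    (hct2 : ContinuousOn (Function.uncurry π2) (S1 ×ˢ S2))
    (hcc1 : ∀ s2 ∈ S2, ConcaveOn ℝ S1 (fun t => π1 t s2))
    (hcc2 : ∀ s1 ∈ S1, ConcaveOn ℝ S2 (fun t => π2 s1 t))
    (s1 : E) (s2 : F)
    (hu : Undominated1 S1 S2 π1 s1)
    (hstack : ∀ s1' : E, Undominated1 S1 S2 π1 s1' →
      sSup ((fun t => π1 s1' t) '' BR2 S2 π2 s1') ≤
        sSup ((fun t => π1 s1 t) '' BR2 S2 π2 s1))
    (hs2 : s2 ∈ BR2 S2 π2 s1)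
    (hmax : ∀ t ∈ BR2 S2 π2 s1, π1 s1 t ≤ π1 s1 s2) :
    ∃ c ∈ S2,
      WeakBBE S1 S2 π1 π2 (fun _ => c) id s1 s2 ∧
      PlausiblyResists S1 S2 π1 π2 (fun _ => c) id s1 s2 := by
  obtain ⟨c, hc, hs1S, hs1c⟩ := hu
  have hstrong : ∀ ψ1' : F → F, IsBelief S2 ψ1' → ∀ s1' s2',
      BiasedNE S1 S2 π1 π2 ψ1' id s1' s2' → π1 s1' s2' ≤ π1 s1 s2 := by
    rintro ψ hψ s1' s2' ⟨h1, h2, h3, h4⟩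
    have hu' : Undominated1 S1 S2 π1 s1' := ⟨ψ s2', hψ.1 h2, h1, h3⟩
    have e := hstack s1' hu'
    have hcont : ContinuousOn (fun t => π1 s1' t) S2 :=
      hct1.comp (continuousOn_const.prodMk continuousOn_id) (fun t ht => ⟨h1, ht⟩)
    have hbdd : BddAbove ((fun t => π1 s1' t) '' BR2 S2 π2 s1') :=
      (hcp2.bddAbove_image hcont).mono (Set.image_mono (fun t ht => ht.1))
    have e1 : π1 s1' s2' ≤ sSup ((fun t => π1 s1' t) '' BR2 S2 π2 s1') :=
      le_csSup hbdd ⟨s2', ⟨h2, h4⟩, rfl⟩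
    have e2 : sSup ((fun t => π1 s1 t) '' BR2 S2 π2 s1) ≤ π1 s1 s2 := by
      refine csSup_le (Set.Nonempty.image _ ⟨s2, hs2⟩) ?_
      rintro _ ⟨t, ht, rfl⟩
      exact hmax t ht
    linarith
  have hP1 : ∀ ψ1' : F → F, IsBelief S2 ψ1' → ∃ s1' s2',
     BiasedNE S1 S2 π1 π2 ψ1' id s1' s2' ∧
     ¬ Implausible1 S1 S2 π1 π2 ψ1' id s1 s2 s1' s2' ∧
     π1 s1' s2' ≤ π1 s1 s2 := by
    intro ψ hψ
    obtain ⟨a, b, hab⟩ := exists_biasedNE S1 S2 hne1 hcp1 hcv1 hne2 hcp2 hcv2 π1 π2 hct1 hct2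
      hcc1 hcc2 ψ hψ
    by_cases him : Implausible1 S1 S2 π1 π2 ψ id s1 s2 a b
    · exact ⟨a, s2, him.2.2, fun h => h.2.1 rfl, hstrong ψ hψ _ _ him.2.2⟩
    · exact ⟨a, b, hab, him, hstrong ψ hψ _ _ hab⟩
  have hP2 : ∀ ψ2' : E → E, IsBelief S1 ψ2' → ∃ s1' s2',
     BiasedNE S1 S2 π1 π2 (fun _ => c) ψ2' s1' s2' ∧
     ¬ Implausible2 S1 S2 π1 π2 (fun _ => c) ψ2' s1 s2 s1' s2' ∧
     π2 s1' s2' ≤ π2 s1 s2 := by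
    intro ψ hψ
    have hcont : ContinuousOn (fun t => π2 (ψ s1) t) S2 :=
      hct2.comp (continuousOn_const.prodMk continuousOn_id) (fun t ht => ⟨hψ.1 hs1S, ht⟩)
    obtain ⟨b, hb, hbm⟩ := hcp2.exists_isMaxOn hne2 hcont
    exact ⟨s1, b, ⟨hs1S, hb, hs1c, fun t ht => hbm ht⟩, fun h => h.2.1 rfl, hs2.2 b hb⟩
  refine ⟨c, hc, ⟨⟨fun _ _ => hc, continuousOn_const⟩, ⟨fun _ h => h, continuousOn_id⟩,
    ⟨hs1S, hs2.1, hs1c, hs2.2⟩, ?_, ?_⟩, hP1, hP2⟩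
  · intro ψ hψ
    obtain ⟨a, b, h1, -, h2⟩ := hP1 ψ hψ
    exact ⟨a, b, h1, h2⟩
  · intro ψ hψ
    obtain ⟨a, b, h1, -, h2⟩ := hP2 ψ hψ
    exact ⟨a, b, h1, h2⟩
end

section
/- Let G be an interval game such that for each player i the payoff π_i(s_i, s_j) is strictly concave in player i's own strategy s_i and convex in the opponent's strategy s_j. Let (s_1*, s_2*) be an undominated strategy profile with π_i(s_1*, s_2*) > M_i^U for each player i. Then (s_1*, s_2*) is a non-monotone strong BBE outcome: there exist continuous biased beliefs ψ* = (ψ_1*, ψ_2*) (not required to be monotone) such that (ψ*, (s_1*, s_2*)) is a weak BBE and π_i(s'_i, s'_j) ≤ π_i(s_1*, s_2*) for every player i, every biased belief ψ'_i, and every (s'_i, s'_j) ∈ NE(G_{(ψ'_i, ψ_j*)}). -/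
open Set

namespace BBEPaper

/-- A BBE in an interval game: a weak BBE with monotone beliefs in which every deviation is
outperformed in some plausible equilibrium of the new biased game. -/
def IsBBE (S1 S2 : Set ℝ) (π1 π2 : ℝ → ℝ → ℝ) (ψ1 ψ2 : ℝ → ℝ) (s1 s2 : ℝ) : Prop :=
  WeakBBE S1 S2 π1 π2 ψ1 ψ2 s1 s2 ∧ MonotoneOn ψ1 S2 ∧ MonotoneOn ψ2 S1 ∧
  PlausiblyResists S1 S2 π1 π2 ψ1 ψ2 s1 s2

/-- A strong BBE in an interval game: a weak BBE with monotone beliefs in which every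
deviation is outperformed in every equilibrium of the new biased game. -/
def IsStrongBBE (S1 S2 : Set ℝ) (π1 π2 : ℝ → ℝ → ℝ) (ψ1 ψ2 : ℝ → ℝ) (s1 s2 : ℝ) : Prop :=
  WeakBBE S1 S2 π1 π2 ψ1 ψ2 s1 s2 ∧ MonotoneOn ψ1 S2 ∧ MonotoneOn ψ2 S1 ∧
  StrongResists S1 S2 π1 π2 ψ1 ψ2 s1 s2

end BBEPaper

open BBEPaper

theorem aux_majorant (L s : ℝ) (u : ℝ → ℝ) (h0 : ∀ x, 0 ≤ u x) (hL : ∀ x, u x ≤ L)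
    (hus : u s = 0) (hc : ContinuousAt u s) :
    ∃ f : ℝ → ℝ, Continuous f ∧ (∀ x, 0 ≤ f x) ∧ f s = 0 ∧ ∀ x, u x ≤ f x := by
  have hL0 : 0 ≤ L := (h0 s).trans (hL s)
  set F : ℝ → ℝ → ℝ := fun r x => u x * min 1 (r / |x - s|) with hF
  have hF0 : ∀ r, 0 ≤ r → ∀ x, 0 ≤ F r x := fun r hr x =>
    mul_nonneg (h0 x) (le_min zero_le_one (div_nonneg hr (abs_nonneg _)))
  have hFL : ∀ r, ∀ x, F r x ≤ L := fun r x => by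
    have h1 : F r x ≤ u x * 1 := mul_le_mul_of_nonneg_left (min_le_left _ _) (h0 x)
    linarith [hL x]
  have hbdd : ∀ r, BddAbove (range (F r)) := fun r => ⟨L, by rintro _ ⟨x, rfl⟩; exact hFL r x⟩
  set G : ℝ → ℝ := fun r => ⨆ x, F r x with hG
  have hFG : ∀ r x, F r x ≤ G r := fun r x => le_ciSup (hbdd r) x
  have hG0 : ∀ r, 0 ≤ r → 0 ≤ G r := fun r hr => (hF0 r hr s).trans (hFG r s)
  have hGle : ∀ r c, (∀ x, F r x ≤ c) → G r ≤ c := fun r c h => ciSup_le h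
  have hmono : ∀ r r', r ≤ r' → G r ≤ G r' := fun r r' h => hGle _ _ fun x =>
    (mul_le_mul_of_nonneg_left (min_le_min_left _ (by gcongr)) (h0 x)).trans (hFG r' x)
  have hscale : ∀ r r', 0 < r → r ≤ r' → G r' ≤ G r * (r' / r) := by
    intro r r' hr h
    refine hGle _ _ fun x => ?_
    have h1 : 1 ≤ r' / r := by rwa [le_div_iff₀ hr, one_mul]
    have h2 : F r' x ≤ F r x * (r' / r) := by
      simp only [hF]
      rw [mul_assoc]
      refine mul_le_mul_of_nonneg_left ?_ (h0 x)
      rw [min_mul_of_nonneg _ _ (by linarith)]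
      refine min_le_min (by linarith) (le_of_eq ?_)
      field_simp
    exact h2.trans (mul_le_mul_of_nonneg_right (hFG r x) (by linarith))
  have hGz : G 0 = 0 := by
    apply le_antisymm
    · refine hGle _ _ fun x => ?_
      simp [hF]
    · exact hG0 0 le_rfl
  refine ⟨fun x => G |x - s|, ?_, fun x => hG0 _ (abs_nonneg _), by simp [hGz], fun x => ?_⟩
  · rw [continuous_iff_continuousAt]
    intro x0
    by_cases hx : x0 = s
    · subst hx
      rw [Metric.continuousAt_iff]
      intro ε hε
      obtain ⟨d, hd, hd'⟩ := Metric.continuousAt_iff.1 hc (ε/2) (by linarith)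
      refine ⟨d * (ε / 2) / (L + 1), by positivity, fun {x} hx => ?_⟩
      rw [Real.dist_eq] at hx
      simp only [sub_self, abs_zero, hGz, Real.dist_eq, sub_zero]
      rw [abs_of_nonneg (hG0 _ (abs_nonneg _))]
      refine lt_of_le_of_lt (hGle _ (ε/2) fun y => ?_) (by linarith)
      by_cases hy : |y - x0| < d
      · have := hd' (x := y) (by rwa [Real.dist_eq])
        rw [Real.dist_eq, hus, sub_zero, abs_of_nonneg (h0 y)] at this
        have h1 : F |x - x0| y ≤ u y * 1 := mul_le_mul_of_nonneg_left (min_le_left _ _) (h0 y)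
        linarith
      · push Not at hy
        have h1 : F |x - x0| y ≤ L * ((ε/2) / (L+1)) := by
          refine mul_le_mul (hL y) ((min_le_right _ _).trans ?_)
            (le_min zero_le_one (by positivity)) hL0
          rw [div_le_iff₀ (by linarith)]
          calc |x - x0| ≤ d * (ε / 2) / (L + 1) := hx.le
            _ = (ε/2) / (L+1) * d := by ring
            _ ≤ _ := by gcongr
        refine h1.trans ?_
        rw [← mul_div_assoc, div_le_iff₀ (by linarith)]
        nlinarith
    · have hr : 0 < |x0 - s| := abs_pos.2 (sub_ne_zero.2 hx)
      set r0 := |x0 - s| with hr0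
      have key : ContinuousAt G r0 := by
        have hlo : Filter.Tendsto (fun r => G r0 * min 1 (r / r0)) (nhds r0) (nhds (G r0)) := by
          have : ContinuousAt (fun r => G r0 * min 1 (r / r0)) r0 := by fun_prop
          simpa [ContinuousAt, div_self hr.ne'] using this
        have hhi : Filter.Tendsto (fun r => G r0 * max 1 (r / r0)) (nhds r0) (nhds (G r0)) := by
          have : ContinuousAt (fun r => G r0 * max 1 (r / r0)) r0 := by fun_prop
          simpa [ContinuousAt, div_self hr.ne'] using this
        refine tendsto_of_tendsto_of_tendsto_of_le_of_le' hlo hhi ?_ ?_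
        · filter_upwards [lt_mem_nhds hr] with r hrp
          rcases le_total r r0 with h | h
          · have := hscale r r0 hrp h
            calc G r0 * min 1 (r / r0) ≤ G r0 * (r / r0) :=
                  mul_le_mul_of_nonneg_left (min_le_right _ _) (hG0 _ hr.le)
              _ ≤ G r * (r0 / r) * (r / r0) := mul_le_mul_of_nonneg_right this (by positivity)
              _ = G r := by field_simp
          · calc G r0 * min 1 (r / r0) ≤ G r0 * 1 :=
                  mul_le_mul_of_nonneg_left (min_le_left _ _) (hG0 _ hr.le)
              _ ≤ G r := by rw [mul_one]; exact hmono _ _ h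
        · filter_upwards [lt_mem_nhds hr] with r hrp
          rcases le_total r r0 with h | h
          · calc G r ≤ G r0 * 1 := by rw [mul_one]; exact hmono _ _ h
              _ ≤ _ := mul_le_mul_of_nonneg_left (le_max_left _ _) (hG0 _ hr.le)
          · exact (hscale r0 r hr h).trans
              (mul_le_mul_of_nonneg_left (le_max_right _ _) (hG0 _ hr.le))
      exact ContinuousAt.comp (f := fun x => |x - s|) (g := G) key (by fun_prop)
  · by_cases hx : x = s
    · subst hx; simp [hGz, hus]
    · have hr : 0 < |x - s| := abs_pos.2 (sub_ne_zero.2 hx)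
      have := hFG |x - s| x
      simpa [hF, div_self hr.ne'] using this

theorem aux_tube {S K : Set ℝ} (hK : IsCompact K) (g : ℝ → ℝ → ℝ) (s : ℝ) (hs : s ∈ S)
    (hg : ContinuousOn (Function.uncurry g) (S ×ˢ K)) (h : ∀ y ∈ K, g s y < 0) :
    ∀ᶠ x in nhdsWithin s S, ∀ y ∈ K, g x y < 0 := by
  have h1 := hK.eventually_forall_of_forall_eventually (x₀ := s)
    (P := fun x y => x ∈ S → y ∈ K → g x y < 0) (fun y hy => by
      have := (hg (s, y) ⟨hs, hy⟩).eventually (gt_mem_nhds (h y hy))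
      rw [eventually_nhdsWithin_iff] at this
      filter_upwards [this] with z hz h1 h2 using hz ⟨h1, h2⟩)
  rw [eventually_nhdsWithin_iff]
  filter_upwards [h1] with x hx hxS y hy using hx y hy hxS hy

theorem aux_select (S : Set ℝ) (L s : ℝ) (hLpos : 0 < L) (hs : s ∈ S) (g : ℝ → ℝ → ℝ)
    (hg : ContinuousOn (Function.uncurry g) (S ×ˢ Icc 0 L))
    (hg0 : g s 0 ≤ 0) (hgs : ∀ θ ∈ Ioc 0 L, g s θ < 0) (hgL : ∀ x ∈ S, g x L ≤ 0) :
    ∃ h : ℝ → ℝ, Continuous h ∧ (∀ x, h x ∈ Icc 0 L) ∧ h s = 0 ∧ ∀ x ∈ S, g x (h x) ≤ 0 := by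
  classical
  set B : ℝ → Set ℝ := fun x => {θ | θ ∈ Icc 0 L ∧ x ∈ S ∧ 0 < g x θ} with hB
  have hBb : ∀ x, BddAbove (B x) := fun x => ⟨L, fun θ h => h.1.2⟩
  have hu0 : ∀ x, 0 ≤ sSup (B x) := fun x => Real.sSup_nonneg fun θ h => h.1.1
  have huL : ∀ x, sSup (B x) ≤ L := fun x => Real.sSup_le (fun θ h => h.1.2) hLpos.le
  have hBs : B s = ∅ := by
    ext θ
    simp only [hB, mem_ofPred_eq, mem_empty_iff_false, iff_false, not_and, not_lt]
    rintro ⟨h1, h2⟩ -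
    rcases h1.eq_or_lt with h | h
    · rw [← h]; exact hg0
    · exact (hgs θ ⟨h, h2⟩).le
  obtain ⟨f, hf, hf0, hfs, huf⟩ := aux_majorant L s (fun x => sSup (B x)) hu0 huL
    (by simp [hBs]) (by
      rw [Metric.continuousAt_iff']
      intro ε hε
      have := aux_tube (S := S) (K := Icc (ε/2) L) isCompact_Icc g s hs
        (hg.mono (prod_mono le_rfl (Icc_subset_Icc_left (by linarith))))
        (fun y hy => hgs y ⟨by linarith [hy.1], hy.2⟩)
      rw [eventually_nhdsWithin_iff] at this
      filter_upwards [this] with x hx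
      rw [Real.dist_eq]
      simp only [hBs, Real.sSup_empty, sub_zero]
      rw [abs_of_nonneg (hu0 x)]
      refine lt_of_le_of_lt (Real.sSup_le (fun θ h => ?_) (by linarith : 0 ≤ ε/2)) (by linarith)
      by_contra hcon
      push Not at hcon
      exact absurd h.2.2 (hx h.2.1 θ ⟨hcon.le, h.1.2⟩).not_gt)
  refine ⟨fun x => min L (f x + |x - s|), by fun_prop,
    fun x => ⟨le_min hLpos.le (add_nonneg (hf0 x) (abs_nonneg _)), min_le_left _ _⟩,
    by simp [hfs, hLpos.le], fun x hx => ?_⟩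
  by_cases hxs : x = s
  · subst hxs; simpa [hfs, hLpos.le] using hg0
  have hr : 0 < |x - s| := abs_pos.2 (sub_ne_zero.2 hxs)
  beta_reduce
  rcases le_total L (f x + |x - s|) with h | h
  · rw [min_eq_left h]; exact hgL x hx
  · rw [min_eq_right h]
    by_contra hcon
    push Not at hcon
    have : f x + |x - s| ≤ sSup (B x) :=
      le_csSup (hBb x) ⟨⟨add_nonneg (hf0 x) (abs_nonneg _), h⟩, hx, hcon⟩
    linarith [huf x]

theorem aux_cross (z : ℝ → ℝ) (hz : ContinuousOn z (Icc 0 1)) (h0 : z 0 = 0) (h1 : z 1 = 1) :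
    ∃ θ0 θ1 : ℝ, 0 ≤ θ0 ∧ θ0 < θ1 ∧ θ1 ≤ 1 ∧ z θ0 = 0 ∧ z θ1 = 1 ∧
      ∀ θ ∈ Ioc θ0 θ1, z θ ∈ Ioc (0:ℝ) 1 := by
  have hc0 : IsCompact (Icc (0:ℝ) 1 ∩ z ⁻¹' {0}) :=
    isCompact_Icc.of_isClosed_subset (hz.preimage_isClosed_of_isClosed isClosed_Icc
      isClosed_singleton) inter_subset_left
  obtain ⟨θ0, ⟨hθ0, hzθ0⟩, hmax⟩ := hc0.exists_isGreatest ⟨0, by simp [h0]⟩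
  have hzθ0 : z θ0 = 0 := hzθ0
  have hlt0 : θ0 < 1 := lt_of_le_of_ne hθ0.2 (by rintro rfl; linarith)
  have hz' : ContinuousOn z (Icc θ0 1) := hz.mono (Icc_subset_Icc_left hθ0.1)
  have hc1 : IsCompact (Icc θ0 1 ∩ z ⁻¹' {1}) :=
    isCompact_Icc.of_isClosed_subset (hz'.preimage_isClosed_of_isClosed isClosed_Icc
      isClosed_singleton) inter_subset_left
  obtain ⟨θ1, ⟨hθ1, hzθ1⟩, hmin⟩ := hc1.exists_isLeast ⟨1, by simp [h1, hlt0.le]⟩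
  have hzθ1 : z θ1 = 1 := hzθ1
  have hlt : θ0 < θ1 := lt_of_le_of_ne hθ1.1 (by rintro rfl; linarith)
  refine ⟨θ0, θ1, hθ0.1, hlt, hθ1.2, hzθ0, hzθ1, fun θ hθ => ⟨?_, ?_⟩⟩
  · by_contra hcon
    push Not at hcon
    obtain ⟨w, hw, hw'⟩ := intermediate_value_Icc hθ.2
      (hz'.mono (Icc_subset_Icc hθ.1.le hθ1.2)) (show (0:ℝ) ∈ Icc (z θ) (z θ1) from
        ⟨hcon, by rw [hzθ1]; exact zero_le_one⟩)
    have := hmax ⟨⟨by linarith [hw.1, hθ.1, hθ0.1], by linarith [hw.2, hθ1.2]⟩, hw'⟩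
    linarith [hw.1, hθ.1]
  · by_contra hcon
    push Not at hcon
    obtain ⟨w, hw, hw'⟩ := intermediate_value_Icc hθ.1.le
      (hz'.mono (Icc_subset_Icc le_rfl (hθ.2.trans hθ1.2))) (show (1:ℝ) ∈ Icc (z θ0) (z θ) from
        ⟨by rw [hzθ0]; exact zero_le_one, hcon.le⟩)
    have := hmin ⟨⟨hw.1, by linarith [hw.2, hθ.2, hθ1.2]⟩, hw'⟩
    have hwe : w = θ := by linarith [hw.2, hθ.2]
    rw [hwe] at hw'
    linarith

theorem aux_belief (S T : Set ℝ) (hS : Convex ℝ S) (br : ℝ → ℝ)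
    (hbr : ContinuousOn br S) (hbrT : MapsTo br S T) (p : ℝ → ℝ → ℝ)
    (hp : Continuous (Function.uncurry p)) (hcv : ∀ x ∈ S, ConvexOn ℝ T (fun y => p x y))
    (s t tp : ℝ) (hs : s ∈ S) (ht : t ∈ S) (htp : tp ∈ S)
    (hpun : ∀ x ∈ S, p x (br tp) < p s (br t)) :
    ∃ ψ : ℝ → ℝ, IsBelief S ψ ∧ br (ψ s) = br t ∧ ∀ x ∈ S, p x (br (ψ x)) ≤ p s (br t) := by
  have hne : br tp - br t ≠ 0 := by
    intro h
    have := hpun s hs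
    rw [sub_eq_zero.1 h] at this
    exact lt_irrefl _ this
  set γ : ℝ → ℝ := fun θ => t + θ * (tp - t) with hγ
  have hγc : Continuous γ := by fun_prop
  have hγS : ∀ θ ∈ Icc (0:ℝ) 1, γ θ ∈ S := fun θ hθ => by
    have := hS ht htp (by linarith [hθ.2] : 0 ≤ 1 - θ) hθ.1 (by ring)
    convert this using 1
    simp [hγ]; ring
  have hy : ContinuousOn (fun θ => br (γ θ)) (Icc 0 1) := hbr.comp hγc.continuousOn hγS
  set z : ℝ → ℝ := fun θ => (br (γ θ) - br t) / (br tp - br t) with hz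
  have hyz : ∀ θ, br (γ θ) = (1 - z θ) * br t + z θ * br tp := fun θ => by
    simp only [hz]; field_simp; ring
  obtain ⟨θ0, θ1, h0, h01, h1, hz0, hz1, hzz⟩ := aux_cross z
    ((hy.sub continuousOn_const).div_const _) (by simp [hz, hγ]) (by simp [hz, hγ, div_self hne])
  have hy0 : br (γ θ0) = br t := by rw [hyz, hz0]; ring
  have hy1 : br (γ θ1) = br tp := by rw [hyz, hz1]; ring
  obtain ⟨h, hhc, hhI, hhs, hhg⟩ := aux_select S (θ1 - θ0) s (by linarith) hs
    (fun x θ => p x (br (γ (θ0 + θ))) - p s (br t)) (by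
      refine ContinuousOn.sub ?_ continuousOn_const
      have : ContinuousOn (fun q : ℝ × ℝ => (q.1, br (γ (θ0 + q.2)))) (S ×ˢ Icc 0 (θ1 - θ0)) := by
        refine continuousOn_fst.prodMk ?_
        refine hy.comp (f := fun q : ℝ × ℝ => θ0 + q.2) (by fun_prop) ?_
        rintro ⟨x, θ⟩ ⟨-, hθ⟩
        exact ⟨by linarith [hθ.1], by linarith [hθ.2]⟩
      exact hp.comp_continuousOn this)
    (by simp [hy0])
    (fun θ hθ => by
      have hzt := hzz (θ0 + θ) ⟨by linarith [hθ.1], by linarith [hθ.2]⟩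
      have hc := (hcv s hs).2 (hbrT ht) (hbrT htp) (by linarith [hzt.2] : 0 ≤ 1 - z (θ0 + θ))
        hzt.1.le (by ring)
      simp only [smul_eq_mul] at hc
      rw [← hyz] at hc
      have := mul_lt_mul_of_pos_left (hpun s hs) hzt.1
      linarith)
    (fun x hx => by
      have := hpun x hx
      have e : θ0 + (θ1 - θ0) = θ1 := by ring
      simp only [e, hy1]
      linarith)
  refine ⟨fun x => γ (θ0 + h x), ⟨fun x _ => hγS _ ⟨?_, ?_⟩, by fun_prop⟩, ?_, fun x hx => ?_⟩
  · linarith [(hhI x).1]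
  · linarith [(hhI x).2]
  · simp [hhs, hy0]
  · linarith [hhg x hx]

theorem aux_br (S T : Set ℝ) (hT : IsCompact T) (hTne : T.Nonempty) (p : ℝ → ℝ → ℝ)
    (hp : Continuous (Function.uncurry p)) (hcc : ∀ x ∈ S, StrictConcaveOn ℝ T (fun y => p x y)) :
    ∃ br : ℝ → ℝ, ContinuousOn br S ∧ MapsTo br S T ∧
      (∀ x ∈ S, ∀ y ∈ T, p x y ≤ p x (br x)) ∧
      ∀ x ∈ S, ∀ y ∈ T, (∀ y' ∈ T, p x y' ≤ p x y) → y = br x := by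
  have hpc : ∀ x, Continuous (fun y => p x y) := fun x =>
    hp.comp (Continuous.prodMk_right x)
  choose br hbrT hbr using fun x => hT.exists_isMaxOn hTne (hpc x).continuousOn
  have huniq : ∀ x ∈ S, ∀ y ∈ T, (∀ y' ∈ T, p x y' ≤ p x y) → y = br x := fun x hx y hy h =>
    (hcc x hx).eq_of_isMaxOn h (hbr x) hy (hbrT x)
  refine ⟨br, fun x hx => ?_, fun x _ => hbrT x, fun x _ y hy => hbr x hy, huniq⟩
  rw [ContinuousWithinAt, tendsto_nhds]
  intro U hU hxU
  have hK : IsCompact (T \ U) := hT.diff hU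
  have hcont : Continuous (Function.uncurry fun x' y => p x' y - p x' (br x)) := by
    refine Continuous.sub hp ?_
    exact hp.comp (f := fun q : ℝ × ℝ => (q.1, br x)) (by fun_prop)
  have := aux_tube (S := S) hK (fun x' y => p x' y - p x' (br x)) x hx hcont.continuousOn
    (fun y hy => by
      have h1 : p x y ≤ p x (br x) := hbr x hy.1
      rcases h1.lt_or_eq with h | h
      · linarith
      · exfalso
        have := huniq x hx y hy.1 (fun y' hy' => by rw [h]; exact hbr x hy')
        exact hy.2 (this ▸ hxU))
  filter_upwards [this] with x' hx'
  by_contra hcon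
  have h1 := hx' (br x') ⟨hbrT x', hcon⟩
  have h2 : p x' (br x) ≤ p x' (br x') := hbr x' (hbrT x)
  linarith


/-- Folk theorem for non-monotone strong BBE in interval games with
payoffs strictly concave in the own strategy and convex in the opponent's strategy: any
undominated profile giving each player strictly more than his undominated minmax payoff is a
non-monotone strong BBE outcome. -/
theorem folk_theorem_nonmonotone_strong_bbe
    (a1 b1 a2 b2 : ℝ) (hab1 : a1 < b1) (hab2 : a2 < b2)
    (S1 S2 : Set ℝ) (hS1 : S1 = Set.Icc a1 b1) (hS2 : S2 = Set.Icc a2 b2)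
    (π1 π2 : ℝ → ℝ → ℝ)
    (hsm1 : ContDiff ℝ 2 (Function.uncurry π1))
    (hsm2 : ContDiff ℝ 2 (Function.uncurry π2))
    (hcc1 : ∀ s2 ∈ S2, StrictConcaveOn ℝ S1 (fun t => π1 t s2))
    (hcc2 : ∀ s1 ∈ S1, StrictConcaveOn ℝ S2 (fun t => π2 s1 t))
    (hcv1 : ∀ s1 ∈ S1, ConvexOn ℝ S2 (fun t => π1 s1 t))
    (hcv2 : ∀ s2 ∈ S2, ConvexOn ℝ S1 (fun t => π2 t s2))
    (s1 s2 : ℝ)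
    (hu1 : Undominated1 S1 S2 π1 s1) (hu2 : Undominated2 S1 S2 π2 s2)
    (hM1 : M1U S1 S2 π1 π2 < π1 s1 s2) (hM2 : M2U S1 S2 π1 π2 < π2 s1 s2) :
    ∃ ψ1 ψ2 : ℝ → ℝ,
      WeakBBE S1 S2 π1 π2 ψ1 ψ2 s1 s2 ∧
      StrongResists S1 S2 π1 π2 ψ1 ψ2 s1 s2 := by
  have hc1 : Continuous (Function.uncurry π1) := hsm1.continuous
  have hc2 : Continuous (Function.uncurry π2) := hsm2.continuous
  have hc1' : Continuous (Function.uncurry fun y x => π1 x y) := hc1.comp continuous_swap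
  have hc2' : Continuous (Function.uncurry fun y x => π2 x y) := hc2.comp continuous_swap
  have hK1 : IsCompact S1 := hS1 ▸ isCompact_Icc
  have hK2 : IsCompact S2 := hS2 ▸ isCompact_Icc
  have hC1 : Convex ℝ S1 := hS1 ▸ convex_Icc _ _
  have hC2 : Convex ℝ S2 := hS2 ▸ convex_Icc _ _
  have hN1 : S1.Nonempty := hS1 ▸ nonempty_Icc.2 hab1.le
  have hN2 : S2.Nonempty := hS2 ▸ nonempty_Icc.2 hab2.le
  obtain ⟨r2, r2c, r2m, r2b, r2u⟩ := aux_br S1 S2 hK2 hN2 π2 hc2 hcc2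
  obtain ⟨r1, r1c, r1m, r1b, r1u⟩ := aux_br S2 S1 hK1 hN1 (fun y x => π1 x y) hc1' hcc1
  obtain ⟨t2, ht2, hs1, hs1b⟩ := hu1
  obtain ⟨t1, ht1, hs2, hs2b⟩ := hu2
  have es1 := r1u t2 ht2 s1 hs1 hs1b
  have es2 := r2u t1 ht1 s2 hs2 hs2b
  obtain ⟨_, ⟨q2, ⟨p1, hp1, hq2, hq2b⟩, rfl⟩, hlt1⟩ := exists_lt_of_csInf_lt
    (Set.Nonempty.image _ (⟨s2, t1, ht1, hs2, hs2b⟩ : {y | Undominated2 S1 S2 π2 y}.Nonempty)) hM1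
  obtain ⟨_, ⟨q1, ⟨p2, hp2, hq1, hq1b⟩, rfl⟩, hlt2⟩ := exists_lt_of_csInf_lt
    (Set.Nonempty.image _ (⟨s1, t2, ht2, hs1, hs1b⟩ : {x | Undominated1 S1 S2 π1 x}.Nonempty)) hM2
  have eq2 := r2u p1 hp1 q2 hq2 hq2b
  have eq1 := r1u p2 hp2 q1 hq1 hq1b
  have hpun1 : ∀ x ∈ S1, π1 x (r2 p1) < π1 s1 (r2 t1) := fun x hx => by
    rw [← eq2, ← es2]
    refine lt_of_le_of_lt (le_csSup ?_ (mem_image_of_mem (fun x => π1 x q2) hx)) hlt1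
    exact (hK1.image (hc1.comp (Continuous.prodMk_left q2))).bddAbove
  have hpun2 : ∀ y ∈ S2, π2 (r1 p2) y < π2 (r1 t2) s2 := fun y hy => by
    rw [← eq1, ← es1]
    refine lt_of_le_of_lt (le_csSup ?_ (mem_image_of_mem (fun y => π2 q1 y) hy)) hlt2
    exact (hK2.image (hc2.comp (Continuous.prodMk_right q1))).bddAbove
  obtain ⟨ψ2, hψ2, hψ2s, hψ2p⟩ := aux_belief S1 S2 hC1 r2 r2c r2m π1 hc1 hcv1 s1 t1 p1 hs1 ht1 hp1
    hpun1
  obtain ⟨ψ1, hψ1, hψ1s, hψ1p⟩ := aux_belief S2 S1 hC2 r1 r1c r1m (fun y x => π2 x y) hc2' hcv2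
    s2 t2 p2 hs2 ht2 hp2 hpun2
  rw [← es2] at hψ2s hψ2p
  simp only [← es1] at hψ1s hψ1p
  have hNE : ∀ φ1 φ2 : ℝ → ℝ, IsBelief S2 φ1 → IsBelief S1 φ2 →
      ∃ x y, BiasedNE S1 S2 π1 π2 φ1 φ2 x y := by
    intro φ1 φ2 h1 h2
    have hm : MapsTo (fun x => r1 (φ1 (r2 (φ2 x)))) S1 S1 := fun x hx =>
      r1m (h1.1 (r2m (h2.1 hx)))
    have hcn : ContinuousOn (fun x => r1 (φ1 (r2 (φ2 x)))) S1 := by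
      have a1 : ContinuousOn (fun x => r2 (φ2 x)) S1 := r2c.comp h2.2 h2.1
      have a2 : ContinuousOn (fun x => φ1 (r2 (φ2 x))) S1 := h1.2.comp a1 (r2m.comp h2.1)
      exact r1c.comp a2 (h1.1.comp (r2m.comp h2.1))
    obtain ⟨x, hx, hfix⟩ : ∃ x ∈ S1, r1 (φ1 (r2 (φ2 x))) = x := by
      rw [hS1] at hm hcn ⊢
      obtain ⟨x, hx, h⟩ := exists_mem_Icc_isFixedPt_of_mapsTo hcn hab1.le hm
      exact ⟨x, hx, h⟩
    refine ⟨x, r2 (φ2 x), hx, r2m (h2.1 hx), fun t ht => ?_, fun t ht => r2b _ (h2.1 hx) t ht⟩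
    have := r1b _ (h1.1 (r2m (h2.1 hx))) t ht
    rwa [hfix] at this
  have hst : StrongResists S1 S2 π1 π2 ψ1 ψ2 s1 s2 := by
    constructor
    · rintro φ hφ x y ⟨hx, hy, -, h⟩
      rw [r2u _ (hψ2.1 hx) y hy h]
      exact hψ2p x hx
    · rintro φ hφ x y ⟨hx, hy, h, -⟩
      rw [r1u _ (hψ1.1 hy) x hx h]
      exact hψ1p y hy
  refine ⟨ψ1, ψ2, ⟨hψ1, hψ2, ⟨hs1, hs2, ?_, ?_⟩, ?_, ?_⟩, hst⟩
  · intro t ht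
    have := r1b _ (hψ1.1 hs2) t ht
    rwa [hψ1s] at this
  · intro t ht
    have := r2b _ (hψ2.1 hs1) t ht
    rwa [hψ2s] at this
  · intro φ hφ
    obtain ⟨x, y, h⟩ := hNE φ ψ2 hφ hψ2
    exact ⟨x, y, h, hst.1 φ hφ x y h⟩
  · intro φ hφ
    obtain ⟨x, y, h⟩ := hNE ψ1 φ hψ1 hφ
    exact ⟨x, y, h, hst.2 φ hφ x y h⟩
end

section
/- Let G be a finite two-player game (with mixed extensions) that admits best replies with full undominated support. Then for any mixed-strategy profile (s_1*, s_2*) the following are equivalent: (1) (s_1*, s_2*) is a monotone weak BBE outcome, i.e., there exist monotone biased beliefs ψ* = (ψ_1*, ψ_2*) such that (ψ*, (s_1*, s_2*)) is a weak BBE; (2) (s_1*, s_2*) is undominated and π_i(s_1*, s_2*) ≥ M_i^U for each player i. -/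
open Set

namespace BBEPaper

/-- Monotonicity of a biased belief in a finite game (on mixed strategies). -/
def FinMonotone {A : Type*} [DecidableEq A] (S : Set (A → ℝ))
    (ψ : (A → ℝ) → (A → ℝ)) : Prop :=
  ∀ s ∈ S, ∀ a a' : A, a' ≠ a → ∀ α ∈ Set.Icc (0 : ℝ) 1,
    ψ (fun b => (1 - α) * s b + α * (if b = a then 1 else 0)) a' ≤ ψ s a'

end BBEPaper

open BBEPaper

section Helpers

variable {A B : Type*} [Fintype A] [Fintype B] [DecidableEq A] [DecidableEq B]

lemma aux_cont (f : (B → ℝ) → (A → ℝ) → ℝ) (u : B → A → ℝ)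
    (hf : ∀ y x, f y x = ∑ b, ∑ a, y b * x a * u b a) :
    Continuous (Function.uncurry f) := by
  have : Function.uncurry f = fun p : (B → ℝ) × (A → ℝ) =>
      ∑ b, ∑ a, p.1 b * p.2 a * u b a := by
    funext p; exact hf p.1 p.2
  rw [this]; fun_prop

lemma aux_lin (g : (B → ℝ) → (A → ℝ) → ℝ) (u : B → A → ℝ)
    (hg : ∀ y x, g y x = ∑ b, ∑ a, y b * x a * u b a) (y : B → ℝ) (x : A → ℝ) :
    g y x = ∑ a, x a * g y (fun b => if b = a then 1 else 0) := by
  simp only [hg]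
  rw [Finset.sum_comm]
  refine Finset.sum_congr rfl fun a _ => ?_
  rw [Finset.mul_sum]
  refine Finset.sum_congr rfl fun b _ => ?_
  simp
  ring

lemma aux_pure (a : A) : (fun b : A => if b = a then (1 : ℝ) else 0) ∈ stdSimplex ℝ A := by
  refine ⟨fun b => ?_, by simp⟩
  dsimp only
  split_ifs <;> norm_num

/-- support of a best reply consists of best replies -/
lemma aux_supp (g : (B → ℝ) → (A → ℝ) → ℝ) (u : B → A → ℝ)
    (hg : ∀ y x, g y x = ∑ b, ∑ a, y b * x a * u b a) (y : B → ℝ) (x : A → ℝ)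
    (hx : x ∈ BR2 (stdSimplex ℝ A) g y) (a : A) (ha : x a ≠ 0) :
    (fun b => if b = a then (1 : ℝ) else 0) ∈ BR2 (stdSimplex ℝ A) g y := by
  obtain ⟨hx1, hx2⟩ := hx
  have h0 : ∑ c, x c * (g y x - g y (fun b => if b = c then 1 else 0)) = 0 := by
    simp only [mul_sub, Finset.sum_sub_distrib]
    rw [← aux_lin g u hg y x, ← Finset.sum_mul, hx1.2]; ring
  rw [Finset.sum_eq_zero_iff_of_nonneg
    (fun c _ => mul_nonneg (hx1.1 c) (sub_nonneg.2 (hx2 _ (aux_pure c))))] at h0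
  have h1 := (mul_eq_zero.1 (h0 a (Finset.mem_univ a))).resolve_left ha
  refine ⟨aux_pure a, fun t ht => ?_⟩
  have := hx2 t ht
  linarith

lemma aux_full (g : (B → ℝ) → (A → ℝ) → ℝ) (u : B → A → ℝ)
    (hg : ∀ y x, g y x = ∑ b, ∑ a, y b * x a * u b a)
    (hfus : ∃ x ∈ stdSimplex ℝ A, Undominated2 (stdSimplex ℝ B) (stdSimplex ℝ A) g x ∧
      Function.support x = {a | Undominated2 (stdSimplex ℝ B) (stdSimplex ℝ A) g
        (fun b => if b = a then 1 else 0)}) :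
    ∃ c ∈ stdSimplex ℝ B, {x | Undominated2 (stdSimplex ℝ B) (stdSimplex ℝ A) g x} =
      BR2 (stdSimplex ℝ A) g c := by
  obtain ⟨x, hx, ⟨c, hc, hxc⟩, hsupp⟩ := hfus
  refine ⟨c, hc, Set.Subset.antisymm ?_ fun z hz => ⟨c, hc, hz⟩⟩
  rintro z ⟨d, hd, hz⟩
  refine ⟨hz.1, fun t ht => ?_⟩
  have key : ∀ a, z a ≠ 0 → g c t ≤ g c (fun b => if b = a then 1 else 0) := by
    intro a ha
    have h1 : a ∈ Function.support x := by
      rw [hsupp]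
      exact ⟨d, hd, aux_supp g u hg d z hz a ha⟩
    exact (aux_supp g u hg c x hxc a h1).2 t ht
  rw [aux_lin g u hg c z]
  calc g c t = ∑ a, z a * g c t := by rw [← Finset.sum_mul, hz.1.2, one_mul]
    _ ≤ _ := by
      refine Finset.sum_le_sum fun a _ => ?_
      by_cases ha : z a = 0
      · simp [ha]
      · exact mul_le_mul_of_nonneg_left (key a ha) (hz.1.1 a)

lemma aux_sup_cont (f : (B → ℝ) → (A → ℝ) → ℝ) (u : B → A → ℝ)
    (hf : ∀ y x, f y x = ∑ b, ∑ a, y b * x a * u b a) :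
    Continuous (fun x => sSup ((fun y => f y x) '' stdSimplex ℝ B)) := by
  refine (isCompact_stdSimplex ℝ B).continuous_sSup (f := fun x y => f y x) ?_
  exact (aux_cont f u hf).comp continuous_swap

lemma aux_le_sup (f : (B → ℝ) → (A → ℝ) → ℝ) (u : B → A → ℝ)
    (hf : ∀ y x, f y x = ∑ b, ∑ a, y b * x a * u b a) (y : B → ℝ) (x : A → ℝ)
    (hy : y ∈ stdSimplex ℝ B) : f y x ≤ sSup ((fun y => f y x) '' stdSimplex ℝ B) := by
  refine le_csSup ?_ ⟨y, hy, rfl⟩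
  have hc : Continuous (fun y => f y x) := (aux_cont f u hf).comp (by fun_prop :
    Continuous fun y : B → ℝ => (y, x))
  exact ((isCompact_stdSimplex ℝ B).image hc).bddAbove

lemma aux_br_s19 [Nonempty A] (g : (B → ℝ) → (A → ℝ) → ℝ) (u : B → A → ℝ)
    (hg : ∀ y x, g y x = ∑ b, ∑ a, y b * x a * u b a) (y : B → ℝ) :
    (BR2 (stdSimplex ℝ A) g y).Nonempty := by
  have hc : Continuous (fun x => g y x) := (aux_cont g u hg).comp (by fun_prop :
    Continuous fun x : A → ℝ => (y, x))
  obtain ⟨x, hx, h⟩ := (isCompact_stdSimplex ℝ A).exists_isMaxOn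
    ⟨_, aux_pure (Classical.arbitrary A)⟩ hc.continuousOn
  exact ⟨x, hx, fun t ht => h ht⟩

lemma aux_br_compact (g : (B → ℝ) → (A → ℝ) → ℝ) (u : B → A → ℝ)
    (hg : ∀ y x, g y x = ∑ b, ∑ a, y b * x a * u b a) (y : B → ℝ) :
    IsCompact (BR2 (stdSimplex ℝ A) g y) := by
  have hc : Continuous (fun x => g y x) := (aux_cont g u hg).comp (by fun_prop :
    Continuous fun x : A → ℝ => (y, x))
  have : BR2 (stdSimplex ℝ A) g y =
      stdSimplex ℝ A ∩ ⋂ t ∈ stdSimplex ℝ A, {x | g y t ≤ g y x} := by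
    ext x; simp [BR2]
  rw [this]
  refine (isCompact_stdSimplex ℝ A).inter_right ?_
  exact isClosed_biInter fun t _ => isClosed_le continuous_const hc

lemma aux_punish [Nonempty A] (f g : (B → ℝ) → (A → ℝ) → ℝ) (v u : B → A → ℝ)
    (hf : ∀ y x, f y x = ∑ b, ∑ a, y b * x a * v b a)
    (hg : ∀ y x, g y x = ∑ b, ∑ a, y b * x a * u b a)
    (c : B → ℝ) (h : {x | Undominated2 (stdSimplex ℝ B) (stdSimplex ℝ A) g x} =
      BR2 (stdSimplex ℝ A) g c) :
    ∃ p ∈ BR2 (stdSimplex ℝ A) g c, ∀ y ∈ stdSimplex ℝ B,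
      f y p ≤ M1U (stdSimplex ℝ B) (stdSimplex ℝ A) f g := by
  obtain ⟨p, hp, hmin⟩ := (aux_br_compact g u hg c).exists_isMinOn (aux_br_s19 g u hg c)
    (aux_sup_cont f v hf).continuousOn
  refine ⟨p, hp, fun y hy => (aux_le_sup f v hf y p hy).trans ?_⟩
  unfold M1U
  rw [h]
  refine le_csInf ⟨_, p, hp, rfl⟩ ?_
  rintro _ ⟨z, hz, rfl⟩
  exact hmin hz

lemma aux_fwd [Nonempty B] (f g : (B → ℝ) → (A → ℝ) → ℝ) (v : B → A → ℝ)
    (hf : ∀ y x, f y x = ∑ b, ∑ a, y b * x a * v b a)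
    (y : B → ℝ) (x : A → ℝ)
    (hx : Undominated2 (stdSimplex ℝ B) (stdSimplex ℝ A) g x)
    (hmax : ∀ t ∈ stdSimplex ℝ B, f t x ≤ f y x) :
    M1U (stdSimplex ℝ B) (stdSimplex ℝ A) f g ≤ f y x := by
  have hne : (stdSimplex ℝ B).Nonempty := ⟨_, aux_pure (Classical.arbitrary B)⟩
  have hle : sSup ((fun y => f y x) '' stdSimplex ℝ B) ≤ f y x := by
    refine csSup_le (hne.image _) ?_
    rintro _ ⟨t, ht, rfl⟩
    exact hmax t ht
  refine le_trans (csInf_le ?_ ⟨x, hx, rfl⟩) hle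
  have hb := ((isCompact_stdSimplex ℝ A).image (aux_sup_cont f v hf)).bddBelow
  refine hb.mono (Set.image_mono ?_)
  rintro z ⟨_, _, hz⟩
  exact hz.1

end Helpers

/-- Folk theorem for monotone weak BBE in finite games admitting best
replies with full undominated support: a mixed profile is a monotone weak BBE outcome iff it
is undominated and gives each player at least his undominated minmax payoff. -/
theorem folk_theorem_monotone_weak_bbe_finite
    {A1 A2 : Type*} [Fintype A1] [Fintype A2] [Nonempty A1] [Nonempty A2]
    [DecidableEq A1] [DecidableEq A2]
    (u1 u2 : A1 → A2 → ℝ)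
    (π1 π2 : (A1 → ℝ) → (A2 → ℝ) → ℝ)
    (hπ1 : ∀ s1 s2, π1 s1 s2 = ∑ a1, ∑ a2, s1 a1 * s2 a2 * u1 a1 a2)
    (hπ2 : ∀ s1 s2, π2 s1 s2 = ∑ a1, ∑ a2, s1 a1 * s2 a2 * u2 a1 a2)
    (S1 : Set (A1 → ℝ)) (S2 : Set (A2 → ℝ))
    (hS1 : S1 = stdSimplex ℝ A1) (hS2 : S2 = stdSimplex ℝ A2)
    (hfus1 : ∃ s1 ∈ S1, Undominated1 S1 S2 π1 s1 ∧
      Function.support s1 =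
        {a1 | Undominated1 S1 S2 π1 (fun a => if a = a1 then 1 else 0)})
    (hfus2 : ∃ s2 ∈ S2, Undominated2 S1 S2 π2 s2 ∧
      Function.support s2 =
        {a2 | Undominated2 S1 S2 π2 (fun a => if a = a2 then 1 else 0)})
    (s1 : A1 → ℝ) (s2 : A2 → ℝ) (hs1 : s1 ∈ S1) (hs2 : s2 ∈ S2) :
    (∃ ψ1 ψ2, WeakBBE S1 S2 π1 π2 ψ1 ψ2 s1 s2 ∧
      FinMonotone S2 ψ1 ∧ FinMonotone S1 ψ2) ↔
    ((Undominated1 S1 S2 π1 s1 ∧ Undominated2 S1 S2 π2 s2) ∧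
      M1U S1 S2 π1 π2 ≤ π1 s1 s2 ∧ M2U S1 S2 π1 π2 ≤ π2 s1 s2) := by
  subst hS1 hS2
  have hf1 : ∀ y x, (fun (y : A2 → ℝ) (x : A1 → ℝ) => π1 x y) y x =
      ∑ b, ∑ a, y b * x a * (fun b a => u1 a b) b a := by
    intro y x
    simp only [hπ1]
    rw [Finset.sum_comm]
    simp only [mul_comm (x _) (y _)]
  have hf2 : ∀ y x, (fun (y : A2 → ℝ) (x : A1 → ℝ) => π2 x y) y x =
      ∑ b, ∑ a, y b * x a * (fun b a => u2 a b) b a := by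
    intro y x
    simp only [hπ2]
    rw [Finset.sum_comm]
    simp only [mul_comm (x _) (y _)]
  constructor
  · rintro ⟨ψ1, ψ2, ⟨hb1, hb2, hne, hd1, hd2⟩, -, -⟩
    refine ⟨⟨⟨ψ1 s2, hb1.1 hs2, hs1, hne.2.2.1⟩, ⟨ψ2 s1, hb2.1 hs1, hs2, hne.2.2.2⟩⟩, ?_, ?_⟩
    · obtain ⟨t1, t2, ⟨h1, h2, h3, h4⟩, hle⟩ := hd1 id ⟨fun _ h => h, continuousOn_id⟩
      exact (aux_fwd π1 π2 u1 hπ1 t1 t2 ⟨ψ2 t1, hb2.1 h1, h2, h4⟩ h3).trans hle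
    · obtain ⟨t1, t2, ⟨h1, h2, h3, h4⟩, hle⟩ := hd2 id ⟨fun _ h => h, continuousOn_id⟩
      exact (aux_fwd (fun y x => π2 x y) (fun y x => π1 x y) _ hf2 t2 t1
        ⟨ψ1 t2, hb1.1 h2, h1, h3⟩ h4).trans hle
  · rintro ⟨⟨hu1, hu2⟩, hm1, hm2⟩
    obtain ⟨c1, hc1, he2⟩ := aux_full π2 u2 hπ2 hfus2
    obtain ⟨c2, hc2, he1⟩ := aux_full (fun y x => π1 x y) _ hf1 hfus1
    obtain ⟨p2, hp2, hq2⟩ := aux_punish π1 π2 u1 u2 hπ1 hπ2 c1 he2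
    obtain ⟨p1, hp1, hq1⟩ := aux_punish (fun y x => π2 x y) (fun y x => π1 x y) _ _ hf2 hf1 c2 he1
    have hB2 : s2 ∈ BR2 (stdSimplex ℝ A2) π2 c1 := he2 ▸ hu2
    have hB1 : s1 ∈ BR2 (stdSimplex ℝ A1) (fun y x => π1 x y) c2 := he1 ▸ hu1
    refine ⟨fun _ => c2, fun _ => c1, ⟨⟨fun _ _ => hc2, continuousOn_const⟩,
      ⟨fun _ _ => hc1, continuousOn_const⟩, ⟨hs1, hs2, hB1.2, hB2.2⟩, ?_, ?_⟩, ?_, ?_⟩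
    · intro ψ hψ
      obtain ⟨t, ht⟩ := aux_br_s19 (fun y x => π1 x y) _ hf1 (ψ p2)
      exact ⟨t, p2, ⟨ht.1, hp2.1, ht.2, hp2.2⟩, (hq2 t ht.1).trans hm1⟩
    · intro ψ hψ
      obtain ⟨t, ht⟩ := aux_br_s19 π2 u2 hπ2 (ψ p1)
      exact ⟨p1, t, ⟨hp1.1, ht.1, hp1.2, ht.2⟩, (hq1 t ht.1).trans hm2⟩
    · intro s _ a a' _ α _
      exact le_rfl
    · intro s _ a a' _ α _
      exact le_rfl
end
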